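/- arXiv:2101.02418 — 2 statements merged into one kernel-verified Lean document; each statement's English description precedes it below -/
import Mathlib

section
/- The interval [σ_RRδ, ⊤] of the lattice 𝓛 of fully invariant congruences on F (equivalently, the subvariety lattice of the monoid variety R ∨ R^δ) is a modular lattice but is not a distributive lattice. -/
/-- The free monoid on countably many generators. -/
abbrev F : Type := FreeMonoid ℕ

/-- The fixed pairwise distinct generators. -/
def x : F := FreeMonoid.of 0
def y : F := FreeMonoid.of 1
def z : F := FreeMonoid.of 2
def t : F := FreeMonoid.of 3

/-- A congruence on `F` is fully invariant if it is stable under every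
monoid endomorphism of `F`. -/
def IsFullyInvariant (c : Con F) : Prop :=
  ∀ ξ : F →* F, ∀ u v : F, c u v → c (ξ u) (ξ v)

/-- The type of fully invariant congruences on `F`. -/
abbrev FICon : Type := {c : Con F // IsFullyInvariant c}

instance : InfSet FICon :=
  ⟨fun S => ⟨sInf (Subtype.val '' S), fun ξ u v h c hc => by
    obtain ⟨d, hd, rfl⟩ := hc
    exact d.2 ξ u v (h d.1 ⟨d, hd, rfl⟩)⟩⟩

/-- The complete lattice of fully invariant congruences on `F`:
meets are intersections, joins are the smallest fully invariant congruences
containing the union, `⊥` is the equality relation and `⊤` is the all relation. -/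
noncomputable instance : CompleteLattice FICon :=
  completeLatticeOfInf FICon (fun S =>
    ⟨fun c hc => fun u v h => h c.1 ⟨c, hc, rfl⟩,
     fun c hc => fun u v h d hd => by
        obtain ⟨e, he, rfl⟩ := hd
        exact hc he h⟩)

/-- `fic S` is the smallest fully invariant congruence on `F` containing the
set `S` of pairs of words. -/
noncomputable def fic (S : Set (F × F)) : FICon :=
  sInf {c : FICon | ∀ p ∈ S, c.1 p.1 p.2}

noncomputable def sigmaRR : FICon :=
  fic {(x ^ 4, x ^ 3), (x ^ 3 * y * z * t, y * x * z * x * t * x),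
       (x * y * z * x * t * y, y * x * z * x * t * y),
       (x * z * x * y * t * y, x * z * y * x * t * y),
       (x * t * y * z * x * y, x * t * y * z * y * x)}

/-! ### Relations on words -/

/-- An equivalence relation on words which is compatible with concatenation and substitution and
contains the identities defining `sigmaRR`. -/
structure IsRRStable (r : List ℕ → List ℕ → Prop) : Prop where
  equiv : Equivalence r
  append : ∀ {l m l' m'}, r l m → r l' m' → r (l ++ l') (m ++ m')
  subst : ∀ (f : ℕ → List ℕ) {l m}, r l m → r (l.flatMap f) (m.flatMap f)
  pow_four : ∀ X, r (X ++ X ++ X ++ X) (X ++ X ++ X)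
  gather : ∀ X Y Z T, r (X ++ X ++ X ++ Y ++ Z ++ T) (Y ++ X ++ Z ++ X ++ T ++ X)
  swap_first : ∀ X Y Z T, r (X ++ Y ++ Z ++ X ++ T ++ Y) (Y ++ X ++ Z ++ X ++ T ++ Y)
  swap_mid : ∀ X Y Z T, r (X ++ Z ++ X ++ Y ++ T ++ Y) (X ++ Z ++ Y ++ X ++ T ++ Y)
  swap_last : ∀ X Y Z T, r (X ++ T ++ Y ++ Z ++ X ++ Y) (X ++ T ++ Y ++ Z ++ Y ++ X)

/-- The number of occurrences of `b` before the first occurrence of `a`. -/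
def countBefore (a b : ℕ) : List ℕ → ℕ
  | [] => 0
  | c :: l => if c = a then 0 else (if c = b then 1 else 0) + countBefore a b l

/-- The word obtained by deleting all occurrences of `a`. -/
def del (a : ℕ) (l : List ℕ) : List ℕ := l.filter (fun c => decide (c ≠ a))

section Words

variable {a b c : ℕ} {l m p q : List ℕ}

theorem countBefore_append_of_mem (h : a ∈ p) :
    countBefore a b (p ++ q) = countBefore a b p := by
  induction p with
  | nil => simp at h
  | cons d p ih =>
    by_cases hd : d = a
    · simp [countBefore, hd]
    · have : a ∈ p := by simpa [Ne.symm hd] using h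
      simp [countBefore, hd, ih this]

theorem countBefore_append_of_notMem (h : a ∉ p) :
    countBefore a b (p ++ q) = p.count b + countBefore a b q := by
  induction p with
  | nil => simp
  | cons d p ih =>
    simp only [List.mem_cons, not_or] at h
    simp only [List.cons_append, countBefore, Ne.symm h.1, if_false, ih h.2, List.count_cons,
      beq_iff_eq]
    omega

theorem countBefore_cons_self : countBefore a b (a :: l) = 0 := by simp [countBefore]

theorem countBefore_self : countBefore a a l = 0 := by
  induction l with
  | nil => rfl
  | cons d l ih => by_cases hd : d = a <;> simp [countBefore, hd, ih]

theorem countBefore_le_count : countBefore a b l ≤ l.count b := by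
  induction l with
  | nil => simp [countBefore]
  | cons d l ih =>
    simp only [countBefore, List.count_cons, beq_iff_eq]
    split_ifs <;> omega

theorem count_del : (del a l).count b = if b = a then 0 else l.count b := by
  unfold del
  split_ifs with h
  · subst h; simp [List.count_eq_zero]
  · rw [List.count_filter]; simpa using h

theorem countBefore_del (ha : a ≠ c) (hb : b ≠ c) :
    countBefore a b (del c l) = countBefore a b l := by
  unfold del
  induction l with
  | nil => rfl
  | cons d l ih =>
    by_cases hd : d = c
    · subst hd
      simpa [countBefore, ha.symm, hb.symm] using ih
    · rw [List.filter_cons_of_pos (by simpa using hd)]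
      simp only [countBefore, ih]

theorem length_del_le : (del a l).length ≤ l.length := List.length_filter_le _ _

theorem length_del_lt (h : a ∈ l) : (del a l).length < l.length := by
  unfold del
  apply lt_of_le_of_ne (List.length_filter_le _ _)
  intro h'
  rw [List.length_filter_eq_length_iff] at h'
  simpa using h' a h

theorem del_eq_self (h : a ∉ l) : del a l = l := by
  unfold del
  rw [List.filter_eq_self]
  intro c hc
  simpa using fun h' : c = a => h (h' ▸ hc)

theorem del_append : del a (l ++ m) = del a l ++ del a m := by simp [del]

theorem del_cons_self : del a (a :: l) = del a l := by simp [del]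

theorem del_cons_of_ne (h : b ≠ a) : del a (b :: l) = b :: del a l := by simp [del, h]

theorem exists_eq_append_of_mem (h : a ∈ l) : ∃ p q, l = p ++ a :: q ∧ a ∉ p := by
  obtain ⟨p, q, h1, h2⟩ := List.eq_append_cons_of_mem h
  exact ⟨p, q, h1, h2⟩

theorem exists_eq_append_append_of_mem (ha : a ∈ l) (hb : b ∈ l) (hab : a ≠ b) :
    ∃ p q s, l = p ++ a :: q ++ b :: s ∨ l = p ++ b :: q ++ a :: s := by
  obtain ⟨p, q, rfl, -⟩ := exists_eq_append_of_mem ha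
  rcases List.mem_append.1 hb with h | h
  · obtain ⟨p', q', rfl, -⟩ := exists_eq_append_of_mem h
    exact ⟨p', q', q, Or.inr (by simp)⟩
  · have h : b ∈ q := by simpa [hab.symm] using h
    obtain ⟨p', q', rfl, -⟩ := exists_eq_append_of_mem h
    exact ⟨p, p', q', Or.inl (by simp)⟩

theorem exists_eq_of_two_le_count (h : 2 ≤ l.count a) :
    ∃ p q s, l = p ++ a :: q ++ a :: s ∧ a ∉ p ∧ a ∉ q := by
  have h1 : a ∈ l := List.count_pos_iff.1 (by omega)
  obtain ⟨p, q, rfl, hp⟩ := exists_eq_append_of_mem h1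
  have h2 : a ∈ q := by
    rw [List.count_append, List.count_eq_zero.2 hp, List.count_cons_self] at h
    exact List.count_pos_iff.1 (by omega)
  obtain ⟨q, s, rfl, hq⟩ := exists_eq_append_of_mem h2
  exact ⟨p, q, s, by simp, hp, hq⟩

/-- The restriction of a word to two letters, one of which occurs once. -/
theorem filter_pair_eq (hab : a ≠ b) (h : l.count a = 1) :
    l.filter (fun c => decide (c = a ∨ c = b)) =
      List.replicate (countBefore a b l) b ++
        a :: List.replicate (l.count b - countBefore a b l) b := by
  have hmem : a ∈ l := List.count_pos_iff.1 (by omega)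
  obtain ⟨p, q, rfl, hp⟩ := exists_eq_append_of_mem hmem
  have hq : a ∉ q := by
    rw [List.count_append, List.count_eq_zero.2 hp, List.count_cons_self] at h
    exact List.count_eq_zero.1 (by omega)
  have key : ∀ s : List ℕ, a ∉ s →
      s.filter (fun c => decide (c = a ∨ c = b)) = List.replicate (s.count b) b := by
    intro s hs
    rw [← List.filter_eq]
    apply List.filter_congr
    intro d hd
    have : d ≠ a := fun h' => hs (h' ▸ hd)
    simp [this, eq_comm]
  rw [countBefore_append_of_notMem hp, List.filter_append, key p hp,
    List.filter_cons_of_pos (by simp), key q hq, countBefore_cons_self]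
  simp [hab]

theorem filter_eq_replicate :
    l.filter (fun c => decide (c = a)) = List.replicate (l.count a) a := by
  rw [← List.filter_eq]

theorem countBefore_le_of_countBefore_eq_zero (ha : a ∈ l) (hab : a ≠ b)
    (h : countBefore b a l = 0) : countBefore b c l ≤ countBefore a c l := by
  induction l with
  | nil => simp at ha
  | cons d l ih =>
    simp only [countBefore] at h ⊢
    by_cases hb : d = b
    · simp [hb]
    · by_cases hd : d = a
      · subst hd; simp [hb] at h
      · have : a ∈ l := by simpa [Ne.symm hd] using ha
        simp only [hb, hd, if_false, zero_add] at h ⊢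
        have := ih this h
        omega

theorem countBefore_le_of_countBefore_ne_zero (h : countBefore b a l ≠ 0) :
    countBefore a c l ≤ countBefore b c l := by
  induction l with
  | nil => simp [countBefore]
  | cons d l ih =>
    simp only [countBefore] at h ⊢
    by_cases hb : d = b
    · simp [hb] at h
    · by_cases hd : d = a
      · simp [hd]
      · simp only [hb, hd, if_false, zero_add] at h ⊢
        have := ih h
        omega

theorem countBefore_add_countBefore_reverse (h : l.count a = 1) (hab : a ≠ b) :
    countBefore a b l + countBefore a b l.reverse = l.count b := by
  have hmem : a ∈ l := List.count_pos_iff.1 (by omega)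
  obtain ⟨p, q, rfl, hp⟩ := exists_eq_append_of_mem hmem
  have hq : a ∉ q := by
    rw [List.count_append, List.count_eq_zero.2 hp, List.count_cons_self] at h
    exact List.count_eq_zero.1 (by omega)
  rw [List.reverse_append, List.reverse_cons, List.append_assoc,
    countBefore_append_of_notMem hp, countBefore_append_of_notMem (by simpa using hq)]
  simp [countBefore_cons_self, hab]

theorem countBefore_append_perm {w s s' v : List ℕ} (h : s.Perm s') (ha : a ∉ s) :
    countBefore a b (w ++ (s ++ v)) = countBefore a b (w ++ (s' ++ v)) := by
  have ha' : a ∉ s' := fun h' => ha (h.mem_iff.2 h')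
  by_cases hw : a ∈ w
  · rw [countBefore_append_of_mem hw, countBefore_append_of_mem hw]
  · rw [countBefore_append_of_notMem hw, countBefore_append_of_notMem hw,
      countBefore_append_of_notMem ha, countBefore_append_of_notMem ha', h.count_eq]

/-- The subword of those occurrences which are not last occurrences. -/
def repeats : List ℕ → List ℕ
  | [] => []
  | c :: l => if c ∈ l then c :: repeats l else repeats l

theorem count_repeats_add : (repeats l).count a + l.dedup.count a = l.count a := by
  induction l with
  | nil => simp [repeats]
  | cons d l ih =>
    by_cases hd : d ∈ l
    · simp only [repeats, hd, if_true, List.dedup_cons_of_mem, List.count_cons]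
      omega
    · simp only [repeats, hd, if_false, List.dedup_cons_of_notMem, List.count_cons,
        not_false_eq_true]
      omega

theorem mem_of_mem_repeats (h : a ∈ repeats l) : a ∈ l := by
  have := List.count_pos_iff.2 h
  have h2 := count_repeats_add (a := a) (l := l)
  exact List.count_pos_iff.1 (by omega)

theorem countBefore_dedup (h : l.count a ≤ 1) (hab : a ≠ b) (hmem : a ∈ l) :
    countBefore a b l.dedup =
      if countBefore a b l = l.count b ∧ 0 < l.count b then 1 else 0 := by
  induction l with
  | nil => simp at hmem
  | cons d l ih =>
    by_cases hda : d = a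
    · subst hda
      have hd : d ∉ l := by
        rw [List.count_cons_self] at h
        exact List.count_eq_zero.1 (by omega)
      rw [List.dedup_cons_of_notMem hd, countBefore_cons_self, countBefore_cons_self]
      rw [if_neg]; omega
    · have hmem' : a ∈ l := by simpa [Ne.symm hda] using hmem
      have h' : l.count a ≤ 1 := by
        rw [List.count_cons] at h
        omega
      have ih := ih h' hmem'
      have hle := countBefore_le_count (a := a) (b := b) (l := l)
      by_cases hd : d ∈ l
      · rw [List.dedup_cons_of_mem hd, ih]
        simp only [countBefore, hda, if_false, List.count_cons, beq_iff_eq]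
        by_cases hdb : d = b
        · subst hdb
          have := List.count_pos_iff.2 hd
          simp only [if_true]
          split_ifs <;> omega
        · simp [hdb]
      · rw [List.dedup_cons_of_notMem hd]
        simp only [countBefore, hda, if_false, List.count_cons, beq_iff_eq, ih]
        by_cases hdb : d = b
        · subst hdb
          have := List.count_eq_zero.2 hd
          simp only [if_true]
          split_ifs <;> omega
        · simp [hdb]

end Words

/-! ### Deriving identities -/

namespace IsRRStable

variable {r s : List ℕ → List ℕ → Prop} {a b c i j : ℕ} {l m p q w v X Y T : List ℕ}

theorem refl (h : IsRRStable r) (l) : r l l := h.equiv.refl l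

theorem symm (h : IsRRStable r) (h' : r l m) : r m l := h.equiv.symm h'

theorem trans (h : IsRRStable r) (h' : r l m) (h'' : r m p) : r l p := h.equiv.trans h' h''

theorem congr (h : IsRRStable r) (p q) (h' : r l m) : r (p ++ l ++ q) (p ++ m ++ q) :=
  h.append (h.append (h.refl p) h') (h.refl q)

theorem filter (h : IsRRStable r) (P : ℕ → Bool) (h' : r l m) : r (l.filter P) (m.filter P) := by
  have key : ∀ s : List ℕ, s.flatMap (fun c => if P c then [c] else []) = s.filter P := by
    intro s
    induction s with
    | nil => rfl
    | cons d s ih => by_cases hd : P d <;> simp [hd, ih]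
  simpa only [key] using h.subst (fun c => if P c then [c] else []) h'

theorem reverse (h : IsRRStable r) : IsRRStable fun l m => r l.reverse m.reverse where
  equiv := ⟨fun _ => h.refl _, h.symm, h.trans⟩
  append h1 h2 := by simpa using h.append h2 h1
  subst f l m h' := by
    have := h.subst (fun c => (f c).reverse) h'
    simpa [List.reverse_flatMap, Function.comp_def] using this
  pow_four X := by simpa using h.pow_four X.reverse
  gather X Y Z T := by
    have h1 := h.gather X.reverse (T.reverse ++ Z.reverse ++ Y.reverse) [] []
    have h2 := h.congr [] Y.reverse (h.gather X.reverse [] T.reverse Z.reverse)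
    simp only [List.reverse_append, List.append_assoc, List.append_nil, List.nil_append] at h1 h2 ⊢
    exact h.trans (h.symm h1) h2
  swap_first X Y Z T := by simpa using h.swap_last Y.reverse X.reverse Z.reverse T.reverse
  swap_mid X Y Z T := by
    simpa using h.swap_mid Y.reverse X.reverse T.reverse Z.reverse
  swap_last X Y Z T := by simpa using h.swap_first Y.reverse X.reverse Z.reverse T.reverse

theorem swap (h : IsRRStable r) (ha : a ∈ w ∨ a ∈ v) (hb : b ∈ w ∨ b ∈ v) :
    r (w ++ b :: a :: v) (w ++ a :: b :: v) := by
  by_cases hab : a = b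
  · subst hab; exact h.refl _
  rcases ha with ha | ha <;> rcases hb with hb | hb
  · obtain ⟨p, q, s, rfl | rfl⟩ := exists_eq_append_append_of_mem ha hb hab
    · simpa using h.symm (h.congr p v (h.swap_last [a] [b] s q))
    · simpa using h.congr p v (h.swap_last [b] [a] s q)
  · obtain ⟨p, q, rfl, -⟩ := exists_eq_append_of_mem ha
    obtain ⟨p', q', rfl, -⟩ := exists_eq_append_of_mem hb
    simpa using h.symm (h.congr p q' (h.swap_mid [a] [b] q p'))
  · obtain ⟨p, q, rfl, -⟩ := exists_eq_append_of_mem hb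
    obtain ⟨p', q', rfl, -⟩ := exists_eq_append_of_mem ha
    simpa using h.congr p q' (h.swap_mid [b] [a] q p')
  · obtain ⟨p, q, s, rfl | rfl⟩ := exists_eq_append_append_of_mem ha hb hab
    · simpa using h.symm (h.congr w s (h.swap_first [a] [b] p q))
    · simpa using h.congr w s (h.swap_first [b] [a] p q)

theorem move_left (h : IsRRStable r) (s v : List ℕ)
    (hs : ∀ s₁ b s₂, s = s₁ ++ b :: s₂ →
      r (w ++ s₁ ++ b :: a :: (s₂ ++ v)) (w ++ s₁ ++ a :: b :: (s₂ ++ v))) :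
    r (w ++ s ++ a :: v) (w ++ a :: s ++ v) := by
  induction s using List.reverseRecOn generalizing v with
  | nil => simpa using h.refl _
  | append_singleton s b ih =>
    have h1 := hs s b [] rfl
    have h2 := ih (b :: v) fun s₁ d s₂ e => by
      simpa using hs s₁ d (s₂ ++ [b]) (by simp [e])
    simp only [List.append_assoc, List.cons_append, List.nil_append] at h1 h2 ⊢
    exact h.trans h1 h2

theorem of_countBefore_eq (h : IsRRStable r)
    (hcount : ∀ a, l.count a = m.count a)
    (hbefore : ∀ a b, l.count a = 1 → countBefore a b l = countBefore a b m) : r l m := by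
  suffices H : ∀ u w v : List ℕ, (∀ a, (w ++ u).count a = (w ++ v).count a) →
      (∀ a b, (w ++ u).count a = 1 → countBefore a b (w ++ u) = countBefore a b (w ++ v)) →
      r (w ++ u) (w ++ v) from H l [] m hcount hbefore
  clear hcount hbefore
  intro u
  induction u with
  | nil =>
    intro w v hc _
    have : v = [] := by
      apply List.eq_nil_iff_forall_not_mem.2
      intro a ha
      have h1 := hc a
      have h2 := List.count_pos_iff.2 ha
      simp only [List.count_append, List.count_nil] at h1
      omega
    subst this
    exact h.refl _
  | cons a u ih =>
    intro w v hc hb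
    have hav : a ∈ v := by
      have h1 := hc a
      simp only [List.count_append, List.count_cons_self] at h1
      exact List.count_pos_iff.1 (by omega)
    obtain ⟨s, v, rfl, has⟩ := exists_eq_append_of_mem hav
    have hlin : ∀ b ∈ s, (w ++ a :: u).count b ≠ 1 := by
      intro b hbs hb1
      have hba : b ≠ a := fun e => has (e ▸ hbs)
      have hbw : b ∉ w := by
        intro hbw
        have h1 := hc b
        rw [hb1] at h1
        have h2 := List.count_pos_iff.2 hbs
        have h3 := List.count_pos_iff.2 hbw
        simp only [List.count_append] at h1
        omega
      have h1 := hb b a hb1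
      rw [countBefore_append_of_notMem hbw, countBefore_append_of_notMem hbw,
        countBefore_append_of_mem hbs] at h1
      have h2 := countBefore_le_count (a := b) (b := a) (l := s)
      rw [List.count_eq_zero.2 has] at h2
      simp only [countBefore, hba.symm, if_false, if_true] at h1
      omega
    have hmem : ∀ s₁ b s₂, s = s₁ ++ b :: s₂ → b ∈ w ++ s₁ ∨ b ∈ s₂ ++ v := by
      intro s₁ b s₂ e
      have h1 := hlin b (by simp [e])
      have hba : b ≠ a := fun e' => has (by simp [e, e'])
      rw [hc, e] at h1
      by_contra! h2
      simp only [List.mem_append, not_or] at h2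
      apply h1
      simp [List.count_eq_zero.2 h2.1.1, List.count_eq_zero.2 h2.1.2,
        List.count_eq_zero.2 h2.2.1, List.count_eq_zero.2 h2.2.2, hba.symm]
    have hmove : r (w ++ s ++ a :: v) (w ++ a :: s ++ v) := by
      refine h.move_left s v fun s₁ b s₂ e => h.swap ?_ (hmem s₁ b s₂ e)
      by_contra! h2
      simp only [List.mem_append, not_or] at h2
      have hca : (w ++ a :: u).count a = 1 := by
        rw [hc, e]
        have hba : b ≠ a := fun e' => has (by simp [e, e'])
        simp [List.count_eq_zero.2 h2.1.1, List.count_eq_zero.2 h2.1.2,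
          List.count_eq_zero.2 h2.2.1, List.count_eq_zero.2 h2.2.2, hba]
      have h3 := hb a b hca
      rw [countBefore_append_of_notMem h2.1.1, countBefore_append_of_notMem h2.1.1,
        countBefore_append_of_notMem has, countBefore_cons_self, countBefore_cons_self, e] at h3
      simp at h3
    have hperm : ∀ d, (w ++ (s ++ a :: v)).count d = (w ++ [a] ++ (s ++ v)).count d := by
      intro d
      simp only [List.count_append, List.count_cons, List.count_nil]
      omega
    have key := ih (w ++ [a]) (s ++ v) (fun d => by rw [← hperm, ← hc]; simp) (fun d e hd => by
      rw [show w ++ [a] ++ u = w ++ a :: u by simp] at hd ⊢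
      rw [hb d e hd]
      have hds : d ∉ s := fun hds => hlin d hds hd
      by_cases hda : d = a
      · subst hda
        have hs : s = [] := by
          apply List.eq_nil_iff_forall_not_mem.2
          intro b hbs
          have h3 := hb d b hd
          have hdw : d ∉ w := by
            intro hdw
            have := List.count_pos_iff.2 hdw
            simp only [List.count_append, List.count_cons_self] at hd
            omega
          rw [countBefore_append_of_notMem hdw, countBefore_append_of_notMem hdw,
            countBefore_append_of_notMem has, countBefore_cons_self, countBefore_cons_self] at h3
          have := List.count_pos_iff.2 hbs
          omega
        simp [hs]
      · have hp : (s ++ [a]).Perm ([a] ++ s) := List.perm_append_comm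
        have := countBefore_append_perm (a := d) (b := e) (w := w) (v := v) hp
          (by simp [hds, hda])
        simpa using this)
    simp only [List.append_assoc, List.cons_append, List.nil_append] at key hmove ⊢
    exact h.trans key (h.symm hmove)

/-! ### Extracting letters -/

theorem cube_append_del (h : IsRRStable r) (a l) :
    r ([a, a, a] ++ l) ([a, a, a] ++ del a l) := by
  induction l with
  | nil => exact h.refl _
  | cons b l ih =>
    by_cases hb : b = a
    · subst hb
      rw [del_cons_self]
      refine h.trans ?_ ih
      simpa using h.congr [] l (h.pow_four [b])
    · rw [del_cons_of_ne hb]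
      have h1 := h.gather [a] [b] [] []
      have h2 := h.congr [] l h1
      have h3 := h.congr [b] [] ih
      have h4 := h.congr [] (del a l) h1
      simp only [List.append_nil, List.nil_append, List.cons_append] at h2 h3 h4 ⊢
      exact h.trans h2 (h.trans h3 (h.symm h4))

theorem cube_extract (h : IsRRStable r) (hl : 3 ≤ l.count a) :
    r l ([a, a, a] ++ del a l) := by
  obtain ⟨p, q, s, rfl, hp, hq⟩ := exists_eq_of_two_le_count (a := a) (l := l) (by omega)
  have hs : a ∈ s := by
    simp only [List.count_append, List.count_cons_self, List.count_eq_zero.2 hp,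
      List.count_eq_zero.2 hq] at hl
    exact List.count_pos_iff.1 (by omega)
  obtain ⟨s, v, rfl, -⟩ := exists_eq_append_of_mem hs
  have h1 := h.congr [] v (h.symm (h.gather [a] p q s))
  have h2 := h.cube_append_del a (p ++ q ++ s ++ v)
  simp only [del_append, del_cons_self, List.append_assoc, List.nil_append,
    List.cons_append] at h1 h2 ⊢
  exact h.trans h1 h2

theorem square_collect (h : IsRRStable r) (hl : l.count a = 2)
    (hlin : ∀ b, l.count b = 1 → countBefore b a l ≠ 1) :
    ∃ p q, r l (p ++ [a, a] ++ q) ∧ del a l = p ++ q := by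
  obtain ⟨p, q, s, rfl, hp, hq⟩ := exists_eq_of_two_le_count (a := a) (l := l) (by omega)
  have hs : a ∉ s := by
    simp only [List.count_append, List.count_cons_self, List.count_eq_zero.2 hp,
      List.count_eq_zero.2 hq] at hl
    exact List.count_eq_zero.1 (by omega)
  refine ⟨p, q ++ s, ?_, ?_⟩
  · have h1 : r (p ++ [a] ++ q ++ a :: s) (p ++ [a] ++ a :: q ++ s) := by
      refine h.move_left q s fun q₁ b q₂ e => h.swap (by simp) ?_
      by_contra! h2
      simp only [List.mem_append, not_or] at h2
      have hba : b ≠ a := fun e' => hq (by simp [e, e'])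
      refine hlin b ?_ ?_
      · simp [e, List.count_eq_zero.2 h2.1.1.1, List.count_eq_zero.2 h2.1.2,
          List.count_eq_zero.2 h2.2.1, List.count_eq_zero.2 h2.2.2, hba.symm]
      · have hq₁ : a ∉ q₁ := fun h' => hq (by simp [e, h'])
        have hb : b ∉ p ++ [a] ++ q₁ := by simp [h2.1.1.1, h2.1.2, hba]
        rw [show p ++ a :: q ++ a :: s = (p ++ [a] ++ q₁) ++ b :: (q₂ ++ a :: s) by simp [e],
          countBefore_append_of_notMem hb, countBefore_cons_self]
        simp [List.count_eq_zero.2 hp, List.count_eq_zero.2 hq₁]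
    simpa using h1
  · simp [del_append, del_cons_self, del_eq_self hp, del_eq_self hq, del_eq_self hs]

end IsRRStable

/-! ### Words up to identities in one linear and one quadratic letter -/

/-- The identity `xtx ≈ txx`: the first of two occurrences of a letter moves freely. -/
def MovesFirst (r : List ℕ → List ℕ → Prop) : Prop := r [0, 1, 0] [1, 0, 0]

/-- The identity `xxt ≈ xtx`: the last of two occurrences of a letter moves freely. -/
def MovesLast (r : List ℕ → List ℕ → Prop) : Prop := r [0, 0, 1] [0, 1, 0]

/-- The identity `xxt ≈ txx`: squares are central. -/
def MovesSquare (r : List ℕ → List ℕ → Prop) : Prop := r [0, 0, 1] [1, 0, 0]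

/-- The words `l` and `m` have the same order of linear letters, and the positions of
quadratic letters relative to linear ones are related by `P`. -/
def Agree (P : ℕ → ℕ → Prop) (l m : List ℕ) : Prop :=
  ∀ a b, a ≠ b → l.count a = 1 →
    (l.count b = 2 → P (countBefore a b l) (countBefore a b m)) ∧
      (l.count b = 1 → countBefore a b l = countBefore a b m)

theorem Agree.del {P : ℕ → ℕ → Prop} {l m : List ℕ} (h : Agree P l m) (c : ℕ) :
    Agree P (del c l) (del c m) := by
  intro a b hab ha
  rw [count_del] at ha
  split_ifs at ha with hac
  rw [count_del]
  by_cases hbc : b = c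
  · simp [hbc]
  · simpa only [hbc, if_false, countBefore_del hac hbc] using h a b hab ha

theorem Agree.eq_of_count_eq_one {P : ℕ → ℕ → Prop} {l m : List ℕ} (h : Agree P l m) {a b : ℕ}
    (ha : l.count a = 1) (hb : l.count b = 1) : countBefore a b l = countBefore a b m := by
  by_cases hab : a = b
  · subst hab; rw [countBefore_self, countBefore_self]
  · exact (h a b hab ha).2 hb

theorem Agree.eq_of_count_le_two {P : ℕ → ℕ → Prop} {l m : List ℕ} (h : Agree P l m) {a b : ℕ}
    (hcount : ∀ a, l.count a = m.count a) (hle : ∀ a, l.count a ≤ 2)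
    (ha : l.count a = 1)
    (H : a ≠ b → l.count b = 2 → P (countBefore a b l) (countBefore a b m) →
      countBefore a b l = countBefore a b m) :
    countBefore a b l = countBefore a b m := by
  have hb := hle b
  by_cases hab : a = b
  · subst hab; rw [countBefore_self, countBefore_self]
  rcases (by omega : l.count b = 0 ∨ l.count b = 1 ∨ l.count b = 2) with h0 | h1 | h2
  · have h3 := countBefore_le_count (a := a) (b := b) (l := l)
    have h4 := countBefore_le_count (a := a) (b := b) (l := m)
    have := hcount b
    omega
  · exact (h a b hab ha).2 h1
  · exact H hab h2 ((h a b hab ha).1 h2)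

namespace IsRRStable

variable {r s : List ℕ → List ℕ → Prop} {a b c i j : ℕ} {l m p q w v X Y T : List ℕ}

theorem movesFirst (h : IsRRStable r) (h' : MovesFirst r) (X T : List ℕ) :
    r (X ++ T ++ X) (T ++ X ++ X) := by
  simpa using h.subst (fun n => if n = 0 then X else T) h'

theorem movesSquare (h : IsRRStable r) (h' : MovesSquare r) (X T : List ℕ) :
    r (X ++ X ++ T) (T ++ X ++ X) := by
  simpa using h.subst (fun n => if n = 0 then X else T) h'

theorem movesFirst_reverse (h : IsRRStable r) (h' : MovesLast r) :
    MovesFirst fun l m => r l.reverse m.reverse := h.symm h'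

theorem movesSquare_of_movesFirst_of_movesLast (h : IsRRStable r) (h1 : MovesFirst r)
    (h2 : MovesLast r) : MovesSquare r := h.trans h2 h1

theorem movesLast_of_movesFirst_of_movesSquare (h : IsRRStable r) (h1 : MovesFirst r)
    (h2 : MovesSquare r) : MovesLast r := h.trans h2 (h.symm h1)

theorem movesFirst_of_movesLast_of_movesSquare (h : IsRRStable r) (h1 : MovesLast r)
    (h2 : MovesSquare r) : MovesFirst r := h.trans (h.symm h1) h2

/-- Letters occurring at least three times may be disregarded. -/
theorem of_agree (h : IsRRStable r) {P : ℕ → ℕ → Prop}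
    (base : ∀ l m, (∀ a, l.count a = m.count a) → (∀ a, l.count a ≤ 2) → Agree P l m → r l m)
    (l m : List ℕ) (hcount : ∀ a, min 3 (l.count a) = min 3 (m.count a)) (hP : Agree P l m) :
    r l m := by
  induction hn : l.length using Nat.strong_induction_on generalizing l m with
  | _ n ih =>
    by_cases hle : ∀ a, l.count a ≤ 2
    · exact base l m (fun a => by have := hcount a; have := hle a; omega) hle hP
    · push Not at hle
      obtain ⟨a, ha⟩ := hle
      have hm : 3 ≤ m.count a := by have := hcount a; omega
      refine h.trans (h.cube_extract ha) (h.trans ?_ (h.symm (h.cube_extract hm)))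
      refine h.append (h.refl _) (ih (del a l).length ?_ _ _ ?_ (hP.del a) rfl)
      · rw [← hn]
        exact length_del_lt (List.count_pos_iff.1 (by omega))
      · intro b
        rw [count_del, count_del]
        split_ifs
        · rfl
        · exact hcount b

theorem of_agree_eq (h : IsRRStable r) (l m : List ℕ) (hcount : ∀ a, l.count a = m.count a)
    (hle : ∀ a, l.count a ≤ 2) (hP : Agree Eq l m) : r l m :=
  h.of_countBefore_eq hcount fun _ _ ha => hP.eq_of_count_le_two hcount hle ha fun _ _ e => e

theorem repeats_append_dedup (h : IsRRStable r) (h' : MovesFirst r) (l : List ℕ) :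
    r l (repeats l ++ l.dedup) := by
  induction l with
  | nil => exact h.refl _
  | cons a l ih =>
    have ih' := h.append (h.refl [a]) ih
    by_cases ha : a ∈ l
    · simpa [repeats, ha] using ih'
    · have h1 : r ([] ++ repeats l ++ a :: l.dedup) ([] ++ a :: repeats l ++ l.dedup) := by
        refine h.move_left (repeats l) l.dedup fun s₁ b s₂ e => ?_
        have hb : b ∈ s₂ ++ l.dedup := by
          have : b ∈ repeats l := by simp [e]
          simp [mem_of_mem_repeats this]
        obtain ⟨p, q, hpq, -⟩ := exists_eq_append_of_mem hb
        rw [hpq]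
        have h2 := h.congr ([] ++ s₁) q (h.movesFirst h' [b] ([a] ++ p))
        have h3 := h.congr ([] ++ s₁ ++ [a]) q (h.symm (h.movesFirst h' [b] p))
        simp only [List.append_assoc, List.nil_append, List.cons_append] at h2 h3 ⊢
        exact h.trans h2 h3
      simp only [repeats, ha, if_false, List.dedup_cons_of_notMem, not_false_eq_true]
      simp only [List.nil_append, List.cons_append] at h1 ih'
      exact h.trans ih' (h.symm h1)

theorem of_agree_movesFirst (h : IsRRStable r) (h' : MovesFirst r) (l m : List ℕ)
    (hcount : ∀ a, l.count a = m.count a) (hle : ∀ a, l.count a ≤ 2)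
    (hP : Agree (fun i j => i = 2 ↔ j = 2) l m) : r l m := by
  refine h.trans (h.repeats_append_dedup h' l) (h.trans ?_
    (h.symm (h.repeats_append_dedup h' m)))
  have hc : ∀ (l : List ℕ) a, (repeats l ++ l.dedup).count a = l.count a := fun l a => by
    rw [List.count_append, count_repeats_add]
  refine h.of_countBefore_eq (fun a => by rw [hc, hc, hcount]) fun a b ha => ?_
  rw [hc] at ha
  by_cases hab : a = b
  · subst hab; rw [countBefore_self, countBefore_self]
  have hformula : ∀ l : List ℕ, l.count a = 1 → countBefore a b (repeats l ++ l.dedup) =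
      (repeats l).count b + if countBefore a b l = l.count b ∧ 0 < l.count b then 1 else 0 := by
    intro l ha
    have hmem : a ∈ l := List.count_pos_iff.1 (by omega)
    have hrep : a ∉ repeats l := by
      have h1 := count_repeats_add (a := a) (l := l)
      have h2 : l.dedup.count a = 1 :=
        List.count_eq_one_of_mem l.nodup_dedup (List.mem_dedup.2 hmem)
      exact List.count_eq_zero.1 (by omega)
    rw [countBefore_append_of_notMem hrep, countBefore_dedup ha.le hab hmem]
  have ham : m.count a = 1 := by rw [← hcount, ha]
  have hrep : (repeats l).count b = (repeats m).count b := by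
    have h1 := count_repeats_add (a := b) (l := l)
    have h2 := count_repeats_add (a := b) (l := m)
    have h3 : l.dedup.count b = m.dedup.count b := by
      rw [List.count_dedup, List.count_dedup]
      have : b ∈ l ↔ b ∈ m := by
        rw [← List.count_pos_iff, ← List.count_pos_iff, hcount]
      simp [this]
    have := hcount b
    omega
  rw [hformula l ha, hformula m ham, hrep, ← hcount b]
  have hPab := hP a b hab ha
  have hb := hle b
  rcases (by omega : l.count b = 0 ∨ l.count b = 1 ∨ l.count b = 2) with h0 | h1 | h2
  · simp [h0]
  · rw [hPab.2 h1]
  · simp [h2, hPab.1 h2]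

theorem of_agree_movesLast (h : IsRRStable r) (h' : MovesLast r) (l m : List ℕ)
    (hcount : ∀ a, l.count a = m.count a) (hle : ∀ a, l.count a ≤ 2)
    (hP : Agree (fun i j => i = 0 ↔ j = 0) l m) : r l m := by
  have key := h.reverse.of_agree_movesFirst (h.movesFirst_reverse h') l.reverse m.reverse
    (by simpa using hcount) (by simpa using hle) ?_
  · simpa using key
  · intro a b hab ha
    rw [List.count_reverse] at ha
    have ham : m.count a = 1 := by rw [← hcount, ha]
    have h1 := countBefore_add_countBefore_reverse ha hab
    have h2 := countBefore_add_countBefore_reverse ham hab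
    have h3 := hP a b hab ha
    have h4 := hcount b
    rw [List.count_reverse]
    constructor
    · intro h5
      have := h3.1 h5
      omega
    · intro h5
      have := h3.2 h5
      omega

theorem square_extract (h : IsRRStable r) (h' : MovesSquare r) (hl : l.count a = 2)
    (hlin : ∀ b, l.count b = 1 → countBefore b a l ≠ 1) : r l ([a, a] ++ del a l) := by
  obtain ⟨p, q, h1, h2⟩ := h.square_collect hl hlin
  have h3 := h.congr [] q (h.symm (h.movesSquare h' [a] p))
  rw [h2]
  simp only [List.append_assoc, List.nil_append, List.cons_append] at h1 h3 ⊢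
  exact h.trans h1 h3

theorem of_agree_movesSquare (h : IsRRStable r) (h' : MovesSquare r) (l m : List ℕ)
    (hcount : ∀ a, l.count a = m.count a) (hle : ∀ a, l.count a ≤ 2)
    (hP : Agree (fun i j => i = 1 ↔ j = 1) l m) : r l m := by
  induction hn : l.length using Nat.strong_induction_on generalizing l m with
  | _ n ih =>
    by_cases hex : ∃ a, l.count a = 2 ∧ ∀ b, l.count b = 1 → countBefore b a l ≠ 1
    · obtain ⟨a, ha, hlin⟩ := hex
      have hlin' : ∀ b, m.count b = 1 → countBefore b a m ≠ 1 := by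
        intro b hb
        rw [← hcount] at hb
        have hab : b ≠ a := by rintro rfl; omega
        exact fun e => hlin b hb (((hP b a hab hb).1 ha).2 e)
      refine h.trans (h.square_extract h' ha hlin) (h.trans ?_
        (h.symm (h.square_extract h' (by rw [← hcount, ha]) hlin')))
      refine h.append (h.refl _) (ih (del a l).length ?_ _ _ ?_ ?_ (hP.del a) rfl)
      · rw [← hn]
        exact length_del_lt (List.count_pos_iff.1 (by omega))
      · intro b
        rw [count_del, count_del, hcount b]
      · intro b
        rw [count_del]
        split_ifs
        · omega
        · exact hle b
    · push Not at hex
      refine h.of_countBefore_eq hcount fun a b ha =>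
        hP.eq_of_count_le_two hcount hle ha fun hab hb hiff => ?_
      obtain ⟨c, hc, hcb⟩ := hex b hb
      have hcb' : countBefore c b m = 1 :=
        ((hP c b (by rintro rfl; omega) hc).1 hb).1 hcb
      by_cases hac : a = c
      · subst hac; rw [hcb, hcb']
      have hmem : ∀ d, l.count d = 1 → d ∈ l ∧ d ∈ m := fun d hd =>
        ⟨List.count_pos_iff.1 (by omega), List.count_pos_iff.1 (by rw [← hcount]; omega)⟩
      have hle1 := countBefore_le_count (a := a) (b := b) (l := l)
      have hle2 := countBefore_le_count (a := a) (b := b) (l := m)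
      rw [← hcount] at hle2
      have horder := hP.eq_of_count_eq_one ha hc
      by_cases h0 : countBefore a c l = 0
      · have h1 := countBefore_le_of_countBefore_eq_zero (c := b) (hmem c hc).1 (Ne.symm hac) h0
        have h2 := countBefore_le_of_countBefore_eq_zero (c := b) (hmem c hc).2 (Ne.symm hac)
          (horder ▸ h0)
        omega
      · have h1 := countBefore_le_of_countBefore_ne_zero (c := b) h0
        have h2 := countBefore_le_of_countBefore_ne_zero (c := b) (horder ▸ h0)
        omega

/-! ### The order on stable relations -/

end IsRRStable

/-- The least `n` such that `xⁿ ≈ xⁿ⁺¹` holds. -/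
noncomputable def powIndex (r : List ℕ → List ℕ → Prop) : ℕ :=
  sInf {n | r (List.replicate n 0) (List.replicate (n + 1) 0)}

/-- The identity `xy ≈ yx`. -/
def Commutes (r : List ℕ → List ℕ → Prop) : Prop := r [0, 1] [1, 0]

/-- Occurrences of non-linear letters move freely. -/
def MovesAll (r : List ℕ → List ℕ → Prop) : Prop := MovesFirst r ∧ MovesLast r

/-- The words `l` and `m` have the same letter counts up to the threshold `n`, and the same order
of linear letters unless `C` holds. -/
def TruncAgree (n : ℕ) (C : Prop) (l m : List ℕ) : Prop :=
  (∀ a, min n (l.count a) = min n (m.count a)) ∧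
    (¬ C → ∀ a b, l.count a = 1 → l.count b = 1 → countBefore a b l = countBefore a b m)

theorem TruncAgree.mono {n n' : ℕ} {C C' : Prop} {l m : List ℕ} (h : TruncAgree n C l m)
    (hn : n' ≤ n) (hC : C → C') : TruncAgree n' C' l m :=
  ⟨fun a => by have := h.1 a; omega, fun hC' => h.2 fun hc => hC' (hC hc)⟩

namespace IsRRStable

variable {r s : List ℕ → List ℕ → Prop} {a b i j k n : ℕ} {l m : List ℕ}

theorem replicate_subst (h : IsRRStable r) (h' : r (List.replicate i a) (List.replicate j a))
    (b : ℕ) : r (List.replicate i b) (List.replicate j b) := by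
  simpa [List.flatMap_replicate] using h.subst (fun _ => [b]) h'

theorem replicate_add (h : IsRRStable r) (h' : r (List.replicate i a) (List.replicate j a))
    (k : ℕ) : r (List.replicate (i + k) a) (List.replicate (j + k) a) := by
  simpa only [List.replicate_add] using h.append h' (h.refl (List.replicate k a))

theorem replicate_of_le (h : IsRRStable r)
    (h' : r (List.replicate n a) (List.replicate (n + 1) a)) (hk : n ≤ k) :
    r (List.replicate n a) (List.replicate k a) := by
  obtain ⟨d, rfl⟩ := Nat.exists_eq_add_of_le hk
  induction d with
  | zero => exact h.refl _
  | succ d ih =>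
    refine h.trans (ih (by omega)) ?_
    have := h.replicate_add h' d
    rwa [show n + 1 + d = n + (d + 1) by omega] at this

theorem replicate_of_min_eq (h : IsRRStable r)
    (h' : r (List.replicate n a) (List.replicate (n + 1) a)) (hij : min n i = min n j) :
    r (List.replicate i a) (List.replicate j a) := by
  by_cases hi : i < n
  · rw [show i = j by omega]; exact h.refl _
  · exact h.trans (h.symm (h.replicate_of_le h' (by omega))) (h.replicate_of_le h' (by omega))

theorem replicate_three (h : IsRRStable r) (a : ℕ) :
    r (List.replicate 3 a) (List.replicate 4 a) := by
  simpa using h.symm (h.pow_four [a])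

theorem powIndex_spec (h : IsRRStable r) (a : ℕ) :
    r (List.replicate (powIndex r) a) (List.replicate (powIndex r + 1) a) :=
  h.replicate_subst (Nat.sInf_mem (s := {n | r (List.replicate n 0) (List.replicate (n + 1) 0)})
    ⟨3, h.replicate_three 0⟩) a

theorem powIndex_le (h : IsRRStable r)
    (h' : r (List.replicate n a) (List.replicate (n + 1) a)) : powIndex r ≤ n :=
  Nat.sInf_le (h.replicate_subst h' 0)

theorem powIndex_le_three (h : IsRRStable r) : powIndex r ≤ 3 := h.powIndex_le (h.replicate_three 0)

theorem powIndex_le_of_lt (h : IsRRStable r)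
    (h' : r (List.replicate i a) (List.replicate j a)) (hij : i < j) : powIndex r ≤ i := by
  obtain ⟨d, rfl⟩ := Nat.exists_eq_add_of_lt hij
  have h1 := h.replicate_add h' (d + 1)
  have h2 := h.replicate_add h' (2 * (d + 1))
  have h3 : r (List.replicate i a) (List.replicate (i + 3 * (d + 1)) a) := by
    refine h.trans h' ?_
    rw [show i + d + 1 = i + (d + 1) by omega] at h1 h2 ⊢
    refine h.trans h1 ?_
    rwa [show i + (d + 1) + (d + 1) = i + 2 * (d + 1) by omega,
      show i + 3 * (d + 1) = i + (d + 1) + 2 * (d + 1) by omega]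
  have h4 : r (List.replicate (i + 3 * (d + 1)) a) (List.replicate (i + 3 * (d + 1) + 1) a) :=
    h.replicate_of_min_eq (h.replicate_three a) (by omega)
  exact h.powIndex_le (h.trans h3 (h.trans h4 (h.symm (h.replicate_add h3 1))))

theorem min_powIndex_count (h : IsRRStable r) (h' : r l m) (a : ℕ) :
    min (powIndex r) (l.count a) = min (powIndex r) (m.count a) := by
  have h1 := h.filter (fun c => decide (c = a)) h'
  rw [filter_eq_replicate, filter_eq_replicate] at h1
  rcases lt_trichotomy (l.count a) (m.count a) with h2 | h2 | h2
  · have := h.powIndex_le_of_lt h1 h2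
    omega
  · rw [h2]
  · have := h.powIndex_le_of_lt (h.symm h1) h2
    omega

theorem commutes (h : IsRRStable r) (h' : Commutes r) (X Y : List ℕ) : r (X ++ Y) (Y ++ X) := by
  simpa using h.subst (fun n => if n = 0 then X else Y) h'

theorem of_perm (h : IsRRStable r) (h' : Commutes r) (hp : l.Perm m) : r l m := by
  induction hp with
  | nil => exact h.refl _
  | cons a _ ih => exact h.append (h.refl [a]) ih
  | swap a b l => exact h.append (h.commutes h' [b] [a]) (h.refl l)
  | trans _ _ ih1 ih2 => exact h.trans ih1 ih2

theorem cube_central (h : IsRRStable r) (X Y : List ℕ) :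
    r (X ++ X ++ X ++ Y) (Y ++ X ++ X ++ X) := by
  simpa using h.gather X Y [] []

theorem commutes_of_powIndex_le_one (h : IsRRStable r) (h' : powIndex r ≤ 1) : Commutes r := by
  have h1 : r (List.replicate 1 0) (List.replicate 3 0) :=
    h.replicate_of_min_eq (h.powIndex_spec 0) (by omega)
  have h2 := h.append h1 (h.refl [1])
  have h3 := h.append (h.refl [1]) h1
  have h4 := h.cube_central [0] [1]
  exact h.trans h2 (h.trans h4 (h.symm h3))

theorem two_le_powIndex (h : IsRRStable r) (hC : ¬ Commutes r) : 2 ≤ powIndex r := by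
  by_contra! h1
  exact hC (h.commutes_of_powIndex_le_one (by omega))

theorem movesAll_of_commutes (h : IsRRStable r) (h' : Commutes r) : MovesAll r :=
  ⟨h.of_perm h' (by decide), h.of_perm h' (by decide)⟩

theorem movesSquare_of_powIndex_le_two (h : IsRRStable r) (h' : powIndex r ≤ 2) :
    MovesSquare r := by
  have h1 : r (List.replicate 2 0) (List.replicate 3 0) :=
    h.replicate_of_min_eq (h.powIndex_spec 0) (by omega)
  have h2 := h.append h1 (h.refl [1])
  have h3 := h.append (h.refl [1]) h1
  have h4 := h.cube_central [0] [1]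
  exact h.trans h2 (h.trans h4 (h.symm h3))

/-- If `x² ≈ x³`, then `xtx` can only be equivalent to words of the form `xtx` unless all
occurrences of non-linear letters move freely. -/
theorem movesAll_of_powIndex_le_two (h : IsRRStable r) (h' : powIndex r ≤ 2)
    (h'' : r [0, 1, 0] (List.replicate i 0 ++ 1 :: List.replicate j 0)) (hij : 2 ≤ i ∨ 2 ≤ j) :
    MovesAll r := by
  have hpow : ∀ k, 2 ≤ k → r (List.replicate k 0) (List.replicate 3 0) := fun k hk =>
    h.replicate_of_min_eq (h.powIndex_spec 0) (by omega)
  have hcube : r ([1] ++ List.replicate 3 0) (List.replicate 3 0 ++ [1]) :=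
    h.symm (h.cube_central [0] [1])
  have key : r [0, 1, 0] (List.replicate 3 0 ++ [1]) := by
    refine h.trans h'' ?_
    rcases hij with hi | hj
    · have h1 := h.congr [] ([1] ++ List.replicate j 0) (hpow i hi)
      have h2 := h.congr [] (List.replicate j 0) (h.symm hcube)
      have h3 := h.congr [1] [] (hpow (3 + j) (by omega))
      rw [List.replicate_add] at h3
      simp only [List.append_assoc, List.nil_append, List.append_nil, List.cons_append]
        at h1 h2 h3 hcube ⊢
      exact h.trans h1 (h.trans h2 (h.trans h3 hcube))
    · have h1 := h.congr (List.replicate i 0 ++ [1]) [] (hpow j hj)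
      have h2 := h.congr (List.replicate i 0) [] hcube
      have h3 := h.congr [] [1] (hpow (i + 3) (by omega))
      rw [List.replicate_add] at h3
      simp only [List.append_assoc, List.nil_append, List.append_nil, List.cons_append]
        at h1 h2 h3 ⊢
      exact h.trans h1 (h.trans h2 h3)
  have h1 := h.append (h.refl [1]) (hpow 2 le_rfl)
  have h2 := h.append (hpow 2 le_rfl) (h.refl [1])
  exact ⟨h.trans key (h.symm (h.trans h1 hcube)), h.trans h2 (h.symm key)⟩

theorem movesSquare_of_movesAll (h : IsRRStable r) (h' : MovesAll r) : MovesSquare r :=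
  h.movesSquare_of_movesFirst_of_movesLast h'.1 h'.2

theorem extract_of_movesAll (h : IsRRStable r) (h' : MovesAll r) (hl : 2 ≤ l.count a) :
    r l (List.replicate (l.count a) a ++ del a l) := by
  by_cases h3 : 3 ≤ l.count a
  · refine h.trans (h.cube_extract h3) (h.append ?_ (h.refl _))
    exact h.replicate_of_min_eq (i := 3) (h.replicate_three a) (by omega)
  · have h2 : l.count a = 2 := by omega
    obtain ⟨p, q, s, rfl, hp, hq⟩ := exists_eq_of_two_le_count hl
    have hs : a ∉ s := by
      simp only [List.count_append, List.count_cons_self, List.count_eq_zero.2 hp,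
        List.count_eq_zero.2 hq] at h2
      exact List.count_eq_zero.1 (by omega)
    rw [h2]
    have h4 := h.congr p s (h.movesFirst h'.1 [a] q)
    have h5 := h.congr [] s (h.symm (h.movesSquare (h.movesSquare_of_movesAll h') [a] (p ++ q)))
    simp only [del_append, del_cons_self, del_eq_self hp, del_eq_self hq, del_eq_self hs,
      List.append_assoc, List.nil_append, List.cons_append, List.replicate] at h4 h5 ⊢
    exact h.trans h4 h5

theorem extract_of_commutes (h : IsRRStable r) (h' : Commutes r) (a : ℕ) (l : List ℕ) :
    r l (List.replicate (l.count a) a ++ del a l) := by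
  refine h.of_perm h' ?_
  rw [← filter_eq_replicate]
  simpa [del] using (List.filter_append_perm (fun c => decide (c = a)) l).symm

theorem of_truncAgree (h : IsRRStable r) (h' : MovesAll r) (l m : List ℕ)
    (hlm : TruncAgree (powIndex r) (Commutes r) l m) : r l m := by
  induction hn : l.length + m.length using Nat.strong_induction_on generalizing l m with
  | _ n ih =>
    have step : ∀ a, (a ∈ l ∨ a ∈ m) → r l (List.replicate (l.count a) a ++ del a l) →
        r m (List.replicate (m.count a) a ++ del a m) → r l m := by
      intro a ha h1 h2
      refine h.trans h1 (h.trans (h.append ?_ (ih _ ?_ _ _ ?_ rfl)) (h.symm h2))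
      · exact h.replicate_of_min_eq (h.powIndex_spec a) (hlm.1 a)
      · have h3 := length_del_le (a := a) (l := l)
        have h4 := length_del_le (a := a) (l := m)
        rcases ha with ha | ha <;> have h5 := length_del_lt ha <;> omega
      · refine ⟨fun b => ?_, fun hC b c hb hc => ?_⟩
        · rw [count_del, count_del]
          split_ifs
          · rfl
          · exact hlm.1 b
        · rw [count_del] at hb hc
          split_ifs at hb hc with h6 h7
          rw [countBefore_del h6 h7, countBefore_del h6 h7]
          exact hlm.2 hC b c hb hc
    by_cases hC : Commutes r
    · by_cases hex : ∃ a, a ∈ l ∨ a ∈ m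
      · obtain ⟨a, ha⟩ := hex
        exact step a ha (h.extract_of_commutes hC a l) (h.extract_of_commutes hC a m)
      · push Not at hex
        rw [List.eq_nil_iff_forall_not_mem.2 fun a => (hex a).1,
          List.eq_nil_iff_forall_not_mem.2 fun a => (hex a).2]
        exact h.refl _
    · have hidx := h.two_le_powIndex hC
      by_cases hex : ∃ a, 2 ≤ l.count a
      · obtain ⟨a, ha⟩ := hex
        have hm : 2 ≤ m.count a := by have := hlm.1 a; omega
        exact step a (Or.inl (List.count_pos_iff.1 (by omega))) (h.extract_of_movesAll h' ha)
          (h.extract_of_movesAll h' hm)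
      · push Not at hex
        have hcount : ∀ a, l.count a = m.count a := fun a => by
          have h1 := hlm.1 a
          have h2 := hex a
          omega
        refine h.of_countBefore_eq hcount fun a b ha => ?_
        by_cases hb : l.count b = 1
        · exact hlm.2 hC a b ha hb
        · have h1 := countBefore_le_count (a := a) (b := b) (l := l)
          have h2 := countBefore_le_count (a := a) (b := b) (l := m)
          have h3 := hcount b
          have h4 := hex b
          omega

/-- The identity in two letters implied by an identity in which one of them is linear. -/
theorem pair (h : IsRRStable r) (h' : r l m) (hab : a ≠ b) (hl : l.count a = 1)
    (hm : m.count a = 1) :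
    r (List.replicate (countBefore a b l) 0 ++
        1 :: List.replicate (l.count b - countBefore a b l) 0)
      (List.replicate (countBefore a b m) 0 ++
        1 :: List.replicate (m.count b - countBefore a b m) 0) := by
  have h1 := h.filter (fun c => decide (c = a ∨ c = b)) h'
  rw [filter_pair_eq hab hl, filter_pair_eq hab hm] at h1
  simpa [List.flatMap_replicate, hab.symm] using h.subst (fun c => if c = a then [1] else [0]) h1

theorem truncAgree (h : IsRRStable r) (h' : r l m) :
    TruncAgree (powIndex r) (Commutes r) l m := by
  refine ⟨h.min_powIndex_count h', fun hC a b ha hb => ?_⟩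
  have hidx := h.two_le_powIndex hC
  by_cases hab : a = b
  · subst hab; rw [countBefore_self, countBefore_self]
  have ha' := h.min_powIndex_count h' a
  have hb' := h.min_powIndex_count h' b
  have h1 := h.pair h' hab ha (by omega)
  have h2 := countBefore_le_count (a := a) (b := b) (l := l)
  have h3 := countBefore_le_count (a := a) (b := b) (l := m)
  rw [show m.count b = 1 by omega] at h1 h3
  rw [hb] at h1 h2
  by_contra hne
  generalize countBefore a b l = i at *
  generalize countBefore a b m = j at *
  apply hC
  rcases (by omega : i = 0 ∧ j = 1 ∨ i = 1 ∧ j = 0) with ⟨rfl, rfl⟩ | ⟨rfl, rfl⟩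
  · exact h.symm h1
  · exact h1

theorem agree_of_not_movesAll (h : IsRRStable r) (hr : ¬ MovesAll r) (hidx : powIndex r = 3)
    (h' : r l m) {P : ℕ → ℕ → Prop} (hrefl : ∀ i, P i i) (hsymm : ∀ i j, P i j → P j i)
    (hfirst : MovesFirst r → P 0 1) (hlast : MovesLast r → P 1 2)
    (hsquare : MovesSquare r → P 0 2) :
    (∀ a, min 3 (l.count a) = min 3 (m.count a)) ∧ Agree P l m := by
  have hcount := h.min_powIndex_count h'
  rw [hidx] at hcount
  refine ⟨hcount, fun a b hab ha => ⟨fun hb => ?_, fun hb => ?_⟩⟩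
  · have ha' := hcount a
    have hb' := hcount b
    have h1 := h.pair h' hab ha (by omega)
    have h2 := countBefore_le_count (a := a) (b := b) (l := l)
    have h3 := countBefore_le_count (a := a) (b := b) (l := m)
    rw [show m.count b = 2 by omega] at h1 h3
    rw [hb] at h1 h2
    generalize countBefore a b l = i at *
    generalize countBefore a b m = j at *
    interval_cases i <;> interval_cases j
    · exact hrefl 0
    · exact hfirst (h.symm h1)
    · exact hsquare (h.symm h1)
    · exact hsymm _ _ (hfirst h1)
    · exact hrefl 1
    · exact hlast (h.symm h1)
    · exact hsymm _ _ (hsquare h1)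
    · exact hsymm _ _ (hlast h1)
    · exact hrefl 2
  · exact (h.truncAgree h').2 (fun hC => hr (h.movesAll_of_commutes hC)) a b ha hb

theorem le_of_powIndex_eq_three (h : IsRRStable r) (hs : IsRRStable s) (hr : ¬ MovesAll r)
    (hidx : powIndex r = 3) (hfirst : MovesFirst r → MovesFirst s)
    (hlast : MovesLast r → MovesLast s) (hsquare : MovesSquare r → MovesSquare s) : r ≤ s := by
  intro l m hlm
  by_cases h1 : MovesFirst r
  · have h2 : ¬ MovesLast r := fun h2 => hr ⟨h1, h2⟩
    have h3 : ¬ MovesSquare r := fun h3 => h2 (h.movesLast_of_movesFirst_of_movesSquare h1 h3)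
    obtain ⟨h4, h5⟩ := h.agree_of_not_movesAll hr hidx hlm (P := fun i j => i = 2 ↔ j = 2)
      (by simp) (fun _ _ => Iff.symm) (by simp) (fun e => (h2 e).elim) (fun e => (h3 e).elim)
    exact hs.of_agree (hs.of_agree_movesFirst (hfirst h1)) l m h4 h5
  by_cases h2 : MovesLast r
  · have h3 : ¬ MovesSquare r := fun h3 => h1 (h.movesFirst_of_movesLast_of_movesSquare h2 h3)
    obtain ⟨h4, h5⟩ := h.agree_of_not_movesAll hr hidx hlm (P := fun i j => i = 0 ↔ j = 0)
      (by simp) (fun _ _ => Iff.symm) (fun e => (h1 e).elim) (by simp) (fun e => (h3 e).elim)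
    exact hs.of_agree (hs.of_agree_movesLast (hlast h2)) l m h4 h5
  by_cases h3 : MovesSquare r
  · obtain ⟨h4, h5⟩ := h.agree_of_not_movesAll hr hidx hlm (P := fun i j => i = 1 ↔ j = 1)
      (by simp) (fun _ _ => Iff.symm) (fun e => (h1 e).elim) (fun e => (h2 e).elim) (by simp)
    exact hs.of_agree (hs.of_agree_movesSquare (hsquare h3)) l m h4 h5
  · obtain ⟨h4, h5⟩ := h.agree_of_not_movesAll hr hidx hlm (P := Eq)
      (fun _ => rfl) (fun _ _ => Eq.symm) (fun e => (h1 e).elim) (fun e => (h2 e).elim)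
      (fun e => (h3 e).elim)
    exact hs.of_agree hs.of_agree_eq l m h4 h5

/-- If `x² ≈ x³` holds, then a word is determined by its letters, the order of the linear ones
and the relative position of the quadratic letters separated by linear ones. -/
theorem of_split_iff (h : IsRRStable r) (h' : powIndex r ≤ 2) (l m : List ℕ)
    (hcount : ∀ a, min 2 (l.count a) = min 2 (m.count a))
    (hlin : ∀ a b, l.count a = 1 → l.count b = 1 → countBefore a b l = countBefore a b m)
    (hsplit : ∀ a b, l.count a = 1 → 2 ≤ l.count b →
      ((l.count b = 2 ∧ countBefore a b l = 1) ↔ (m.count b = 2 ∧ countBefore a b m = 1))) :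
    r l m := by
  have hsq := h.movesSquare_of_powIndex_le_two h'
  induction hn : l.length using Nat.strong_induction_on generalizing l m with
  | _ n ih =>
    have extract : ∀ (l : List ℕ) (b : ℕ), 2 ≤ l.count b →
        (∀ a, l.count a = 1 → ¬ (l.count b = 2 ∧ countBefore a b l = 1)) →
        r l ([b, b] ++ del b l) := by
      intro l b hb hbl
      by_cases h3 : 3 ≤ l.count b
      · refine h.trans (h.cube_extract h3) (h.append ?_ (h.refl _))
        exact h.replicate_of_min_eq (i := 3) (j := 2) (h.powIndex_spec b) (by omega)
      · have h2 : l.count b = 2 := by omega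
        exact h.square_extract hsq h2 fun a ha e => hbl a ha ⟨h2, e⟩
    by_cases hex : ∃ b, 2 ≤ l.count b ∧
        ∀ a, l.count a = 1 → ¬ (l.count b = 2 ∧ countBefore a b l = 1)
    · obtain ⟨b, hb, hbl⟩ := hex
      have hbm : 2 ≤ m.count b := by have := hcount b; omega
      refine h.trans (extract l b hb hbl) (h.trans ?_ (h.symm (extract m b hbm fun a ha => ?_)))
      · refine h.append (h.refl _) (ih (del b l).length ?_ _ _ ?_ ?_ ?_ rfl)
        · rw [← hn]
          exact length_del_lt (List.count_pos_iff.1 (by omega))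
        · intro a
          rw [count_del, count_del]
          split_ifs
          · rfl
          · exact hcount a
        · intro a c ha hc
          rw [count_del] at ha hc
          split_ifs at ha hc with h1 h2
          rw [countBefore_del h1 h2, countBefore_del h1 h2]
          exact hlin a c ha hc
        · intro a c ha hc
          rw [count_del] at ha hc
          split_ifs at ha hc with h1 h2
          · omega
          · rw [countBefore_del h1 h2, countBefore_del h1 h2, count_del, count_del, if_neg h2,
              if_neg h2]
            exact hsplit a c ha hc
      · have ha' : l.count a = 1 := by have := hcount a; omega
        exact fun e => hbl a ha' ((hsplit a b ha' hb).2 e)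
    · push Not at hex
      have hle : ∀ b, l.count b ≤ 2 := by
        intro b
        by_contra! hb
        obtain ⟨a, _, h2, _⟩ := hex b (by omega)
        omega
      refine h.of_agree_movesSquare hsq l m (fun b => ?_) hle fun a b _ ha =>
        ⟨fun hb => ?_, hlin a b ha⟩
      · have h1 := hcount b
        have h2 := hle b
        by_cases hb : l.count b = 2
        · obtain ⟨a, ha, e⟩ := hex b (by omega)
          rw [((hsplit a b ha hb.ge).1 e).1, hb]
        · omega
      · obtain ⟨c, hc, e⟩ := hex b (by omega)
        have h1 := hsplit a b ha hb.ge
        have h2 := ((hsplit c b hc hb.ge).1 e).1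
        simpa [hb, h2] using h1

theorem le_of_powIndex_le_two (h : IsRRStable r) (hs : IsRRStable s) (hr : ¬ MovesAll r)
    (hidx : powIndex r ≤ 2) (hidx' : powIndex s ≤ 2) : r ≤ s := by
  intro l m hlm
  have hC : ¬ Commutes r := fun hC => hr (h.movesAll_of_commutes hC)
  have htwo := h.two_le_powIndex hC
  obtain ⟨hcount, hlin⟩ := h.truncAgree hlm
  rw [show powIndex r = 2 by omega] at hcount
  refine hs.of_split_iff hidx' l m hcount (hlin hC) fun a b ha hb => ?_
  have ha' := hcount a
  have hb' := hcount b
  have hab : a ≠ b := by rintro rfl; omega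
  have h1 := h.pair hlm hab ha (by omega)
  have h2 := countBefore_le_count (a := a) (b := b) (l := l)
  have h3 := countBefore_le_count (a := a) (b := b) (l := m)
  constructor
  · rintro ⟨e1, e2⟩
    rw [e1, e2] at h1
    by_contra hne
    exact hr (h.movesAll_of_powIndex_le_two hidx h1 (by omega))
  · rintro ⟨e1, e2⟩
    rw [e1, e2] at h1
    by_contra hne
    exact hr (h.movesAll_of_powIndex_le_two hidx (h.symm h1) (by omega))

theorem powIndex_anti (h : IsRRStable r) (hs : IsRRStable s) (hrs : r ≤ s) :
    powIndex s ≤ powIndex r := hs.powIndex_le (hrs _ _ (h.powIndex_spec 0))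

/-- Stable relations are determined by the identities `xtx ≈ txx`, `xxt ≈ xtx`, `xxt ≈ txx`,
`xⁿ ≈ xⁿ⁺¹` and `xy ≈ yx`. -/
theorem le_of_imp (h : IsRRStable r) (hs : IsRRStable s) (hfirst : MovesFirst r → MovesFirst s)
    (hlast : MovesLast r → MovesLast s) (hsquare : MovesSquare r → MovesSquare s)
    (hidx : powIndex s ≤ powIndex r) (hC : Commutes r → Commutes s) : r ≤ s := by
  by_cases hs' : MovesAll s
  · exact fun _ _ hlm => hs.of_truncAgree hs' _ _ ((h.truncAgree hlm).mono hidx hC)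
  have hr : ¬ MovesAll r := fun hr => hs' ⟨hfirst hr.1, hlast hr.2⟩
  by_cases h3 : powIndex r = 3
  · exact h.le_of_powIndex_eq_three hs hr h3 hfirst hlast hsquare
  · have := h.powIndex_le_three
    exact h.le_of_powIndex_le_two hs hr (by omega) (by omega)

/-! ### Isoterms -/

theorem replicate_isoterm (h : IsRRStable r) (hk : k < powIndex r) (hm : r (List.replicate k 0) m) :
    m = List.replicate k 0 := by
  have hcount := h.min_powIndex_count hm
  have h1 : ∀ b ∈ m, b = 0 := by
    intro b hb
    by_contra hb0
    have h2 := hcount b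
    have h3 := List.count_pos_iff.2 hb
    rw [List.count_replicate] at h2
    simp only [beq_iff_eq, Ne.symm hb0, if_false] at h2
    omega
  have h2 := hcount 0
  rw [List.eq_replicate_of_mem h1] at h2 ⊢
  simp only [List.count_replicate_self] at h2
  rw [show m.length = k by omega]

/-- A word equivalent to a word in `x` and `t` which is linear in `t` is of the same form. -/
theorem exists_eq_of_linear (h : IsRRStable r) (hC : ¬ Commutes r)
    (hm : r (List.replicate i 0 ++ 1 :: List.replicate j 0) m) :
    ∃ i' j', m = List.replicate i' 0 ++ 1 :: List.replicate j' 0 ∧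
      min (powIndex r) (i + j) = min (powIndex r) (i' + j') := by
  have htwo := h.two_le_powIndex hC
  have hcount := h.min_powIndex_count hm
  have h1 : m.count 1 = 1 := by
    have := hcount 1
    simp [List.count_replicate] at this
    omega
  have h2 : m.filter (fun c => decide (c = 1 ∨ c = 0)) = m := by
    rw [List.filter_eq_self]
    intro b hb
    have h3 := hcount b
    have h4 := List.count_pos_iff.2 hb
    by_contra hb'
    simp only [decide_eq_true_eq, not_or] at hb'
    simp [List.count_replicate, Ne.symm hb'.1, Ne.symm hb'.2] at h3
    omega
  rw [filter_pair_eq one_ne_zero h1] at h2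
  refine ⟨_, _, h2.symm, ?_⟩
  have h3 := hcount 0
  have h4 := countBefore_le_count (a := 1) (b := 0) (l := m)
  simp at h3
  omega

theorem pair_isoterm (h : IsRRStable r) (hC : ¬ Commutes r) (hm : r [0, 1] m) : m = [0, 1] := by
  have htwo := h.two_le_powIndex hC
  obtain ⟨i, j, rfl, hij⟩ := h.exists_eq_of_linear (i := 1) (j := 0) hC hm
  rcases (by omega : i = 1 ∧ j = 0 ∨ i = 0 ∧ j = 1) with ⟨rfl, rfl⟩ | ⟨rfl, rfl⟩
  · rfl
  · exact (hC hm).elim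

theorem split_isoterm (h : IsRRStable r) (h1 : ¬ MovesFirst r) (h2 : ¬ MovesLast r)
    (hm : r [0, 1, 0] m) : m = [0, 1, 0] := by
  have hC : ¬ Commutes r := fun hC => h1 (h.movesAll_of_commutes hC).1
  have htwo := h.two_le_powIndex hC
  obtain ⟨i, j, rfl, hij⟩ := h.exists_eq_of_linear (i := 1) (j := 1) hC hm
  by_cases hidx : powIndex r ≤ 2
  · by_cases hij' : 2 ≤ i ∨ 2 ≤ j
    · exact (h1 (h.movesAll_of_powIndex_le_two hidx hm hij').1).elim
    · obtain ⟨rfl, rfl⟩ : i = 1 ∧ j = 1 := by omega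
      rfl
  · rcases (by omega : i = 1 ∧ j = 1 ∨ i = 0 ∧ j = 2 ∨ i = 2 ∧ j = 0) with
      ⟨rfl, rfl⟩ | ⟨rfl, rfl⟩ | ⟨rfl, rfl⟩
    · rfl
    · exact (h1 hm).elim
    · exact (h2 (h.symm hm)).elim

theorem last_square_isoterm (h : IsRRStable r) (h1 : ¬ MovesFirst r) (h2 : ¬ MovesSquare r)
    (hm : r [1, 0, 0] m) : m = [1, 0, 0] := by
  have hC : ¬ Commutes r := fun hC => h1 (h.movesAll_of_commutes hC).1
  have htwo : ¬ powIndex r ≤ 2 := fun e => h2 (h.movesSquare_of_powIndex_le_two e)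
  obtain ⟨i, j, rfl, hij⟩ := h.exists_eq_of_linear (i := 0) (j := 2) hC hm
  rcases (by omega : i = 1 ∧ j = 1 ∨ i = 0 ∧ j = 2 ∨ i = 2 ∧ j = 0) with
    ⟨rfl, rfl⟩ | ⟨rfl, rfl⟩ | ⟨rfl, rfl⟩
  · exact (h1 (h.symm hm)).elim
  · rfl
  · exact (h2 (h.symm hm)).elim

theorem first_square_isoterm (h : IsRRStable r) (h1 : ¬ MovesLast r) (h2 : ¬ MovesSquare r)
    (hm : r [0, 0, 1] m) : m = [0, 0, 1] := by
  have hC : ¬ Commutes r := fun hC => h1 (h.movesAll_of_commutes hC).2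
  have htwo : ¬ powIndex r ≤ 2 := fun e => h2 (h.movesSquare_of_powIndex_le_two e)
  obtain ⟨i, j, rfl, hij⟩ := h.exists_eq_of_linear (i := 2) (j := 0) hC hm
  rcases (by omega : i = 1 ∧ j = 1 ∨ i = 0 ∧ j = 2 ∨ i = 2 ∧ j = 0) with
    ⟨rfl, rfl⟩ | ⟨rfl, rfl⟩ | ⟨rfl, rfl⟩
  · exact (h1 hm).elim
  · exact (h2 hm).elim
  · rfl

end IsRRStable

/-! ### Fully invariant congruences as relations on words -/

open FreeMonoid (ofList)

/-- A fully invariant congruence as a relation on lists of letters. -/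
def wordRel (c : FICon) (l m : List ℕ) : Prop := c.1 (ofList l) (ofList m)

theorem lift_ofList_eq (f : ℕ → List ℕ) (l : List ℕ) :
    FreeMonoid.lift (fun n => ofList (f n)) (ofList l) = ofList (l.flatMap f) := by
  induction l with
  | nil => rfl
  | cons a l ih =>
    rw [FreeMonoid.ofList_cons, map_mul, FreeMonoid.lift_eval_of, ih, List.flatMap_cons,
      FreeMonoid.ofList_append]

theorem wordRel_le_wordRel {c d : FICon} : wordRel c ≤ wordRel d ↔ c ≤ d := Iff.rfl

theorem wordRel_inf {c d : FICon} {l m : List ℕ} :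
    wordRel (c ⊓ d) l m ↔ wordRel c l m ∧ wordRel d l m := by
  refine ⟨fun h => ⟨(inf_le_left : c ⊓ d ≤ c) h, (inf_le_right : c ⊓ d ≤ d) h⟩, fun h => ?_⟩
  let e : FICon := ⟨c.1 ⊓ d.1, fun ξ u v huv => ⟨c.2 ξ u v huv.1, d.2 ξ u v huv.2⟩⟩
  have hc : e ≤ c := fun _ _ huv => huv.1
  have hd : e ≤ d := fun _ _ huv => huv.2
  exact le_inf hc hd h

theorem fic_le_iff {S : Set (F × F)} {c : FICon} : fic S ≤ c ↔ ∀ p ∈ S, c.1 p.1 p.2 := by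
  refine ⟨fun h p hp => h ?_, fun h => sInf_le h⟩
  rintro _ ⟨d, hd, rfl⟩
  exact hd p hp

theorem isRRStable_wordRel {c : FICon} (hc : sigmaRR ≤ c) : IsRRStable (wordRel c) := by
  have hc := fic_le_iff.1 hc
  simp only [Set.mem_insert_iff, Set.mem_singleton_iff, forall_eq_or_imp, forall_eq] at hc
  obtain ⟨h1, h2, h3, h4, h5⟩ := hc
  have key : ∀ X Y Z T : List ℕ, ∃ ξ : F →* F,
      ξ x = ofList X ∧ ξ y = ofList Y ∧ ξ z = ofList Z ∧ ξ t = ofList T := fun X Y Z T =>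
    ⟨FreeMonoid.lift fun n =>
      if n = 0 then ofList X else if n = 1 then ofList Y else if n = 2 then ofList Z else ofList T,
      by simp [x], by simp [y], by simp [z], by simp [t]⟩
  refine ⟨⟨fun l => c.1.refl _, fun h => c.1.symm h, fun h h' => c.1.trans h h'⟩,
    fun h h' => c.1.mul h h', fun f l m h => ?_, fun X => ?_, fun X Y Z T => ?_,
    fun X Y Z T => ?_, fun X Y Z T => ?_, fun X Y Z T => ?_⟩
  · have h' := c.2 (FreeMonoid.lift fun n => ofList (f n)) _ _ h
    rwa [lift_ofList_eq, lift_ofList_eq] at h'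
  · obtain ⟨ξ, hx, -⟩ := key X [] [] []
    have h := c.2 ξ _ _ h1
    simp only [pow_succ, pow_zero, one_mul, map_mul, hx] at h
    exact h
  all_goals
    obtain ⟨ξ, hx, hy, hz, ht⟩ := key X Y Z T
  · have h := c.2 ξ _ _ h2
    simp only [pow_succ, pow_zero, one_mul, map_mul, hx, hy, hz, ht] at h
    exact h
  · have h := c.2 ξ _ _ h3
    simp only [map_mul, hx, hy, hz, ht] at h
    exact h
  · have h := c.2 ξ _ _ h4
    simp only [map_mul, hx, hy, hz, ht] at h
    exact h
  · have h := c.2 ξ _ _ h5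
    simp only [map_mul, hx, hy, hz, ht] at h
    exact h

/-- The largest fully invariant congruence for which `w` is an isoterm. -/
def isotermCon (w : List ℕ) : FICon where
  val :=
    { r := fun u v => ∀ (ξ : F →* F) (p q : F), p * ξ u * q = ofList w ↔ p * ξ v * q = ofList w
      iseqv := ⟨fun _ _ _ _ => Iff.rfl, fun h ξ p q => (h ξ p q).symm,
        fun h h' ξ p q => (h ξ p q).trans (h' ξ p q)⟩
      mul' := fun {u u' v v'} h h' ξ p q => by
        have h1 := h ξ p (ξ v * q)
        have h2 := h' ξ (p * ξ u') q
        simp only [map_mul, mul_assoc] at h1 h2 ⊢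
        exact h1.trans h2 }
  property := fun η _ _ h ξ p q => h (ξ.comp η) p q

theorem isotermCon_isoterm {w m : List ℕ} (h : wordRel (isotermCon w) w m) : m = w := by
  have h' := (h (MonoidHom.id F) 1 1).1
  simp only [MonoidHom.id_apply, one_mul, mul_one, forall_const] at h'
  exact h'

theorem le_isotermCon {c : FICon} {w : List ℕ} (h : ∀ m, wordRel c w m → m = w) :
    c ≤ isotermCon w := by
  have key : ∀ u v, c.1 u v → ∀ (ξ : F →* F) (p q : F),
      p * ξ u * q = ofList w → p * ξ v * q = ofList w := fun u v huv ξ p q e =>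
    h _ (show c.1 (ofList w) (p * ξ v * q) from
      e ▸ c.1.mul (c.1.mul (c.1.refl p) (c.2 ξ _ _ huv)) (c.1.refl q))
  exact fun u v huv ξ p q => ⟨key u v huv ξ p q, key v u (c.1.symm huv) ξ p q⟩

theorem sup_isoterm {c d : FICon} {w m : List ℕ} (hc : ∀ m, wordRel c w m → m = w)
    (hd : ∀ m, wordRel d w m → m = w) (h : wordRel (c ⊔ d) w m) : m = w :=
  isotermCon_isoterm (sup_le (le_isotermCon hc) (le_isotermCon hd) h)

/-! ### Modularity -/

section Sup

variable {c d : FICon}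

theorem commutes_sup (hc : sigmaRR ≤ c) (hd : sigmaRR ≤ d) (h : Commutes (wordRel (c ⊔ d))) :
    Commutes (wordRel c) ∨ Commutes (wordRel d) := by
  by_contra! hn
  have := sup_isoterm (fun _ => (isRRStable_wordRel hc).pair_isoterm hn.1)
    (fun _ => (isRRStable_wordRel hd).pair_isoterm hn.2) h
  simp at this

theorem movesFirst_or_movesLast_of_sup (hc : sigmaRR ≤ c) (hd : sigmaRR ≤ d)
    (h : MovesFirst (wordRel (c ⊔ d)) ∨ MovesLast (wordRel (c ⊔ d))) :
    (MovesFirst (wordRel c) ∨ MovesLast (wordRel c)) ∨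
      (MovesFirst (wordRel d) ∨ MovesLast (wordRel d)) := by
  by_contra! hn
  have key : ∀ m, wordRel (c ⊔ d) [0, 1, 0] m → m = [0, 1, 0] := fun _ =>
    sup_isoterm (fun _ => (isRRStable_wordRel hc).split_isoterm hn.1.1 hn.1.2)
      (fun _ => (isRRStable_wordRel hd).split_isoterm hn.2.1 hn.2.2)
  rcases h with h | h
  · simpa using key _ h
  · simpa using key _ ((c ⊔ d).1.symm h)

theorem movesFirst_or_movesSquare_of_sup (hc : sigmaRR ≤ c) (hd : sigmaRR ≤ d)
    (h : MovesFirst (wordRel (c ⊔ d)) ∨ MovesSquare (wordRel (c ⊔ d))) :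
    (MovesFirst (wordRel c) ∨ MovesSquare (wordRel c)) ∨
      (MovesFirst (wordRel d) ∨ MovesSquare (wordRel d)) := by
  by_contra! hn
  have key : ∀ m, wordRel (c ⊔ d) [1, 0, 0] m → m = [1, 0, 0] := fun _ =>
    sup_isoterm (fun _ => (isRRStable_wordRel hc).last_square_isoterm hn.1.1 hn.1.2)
      (fun _ => (isRRStable_wordRel hd).last_square_isoterm hn.2.1 hn.2.2)
  rcases h with h | h
  · simpa using key _ ((c ⊔ d).1.symm h)
  · simpa using key _ ((c ⊔ d).1.symm h)

theorem movesLast_or_movesSquare_of_sup (hc : sigmaRR ≤ c) (hd : sigmaRR ≤ d)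
    (h : MovesLast (wordRel (c ⊔ d)) ∨ MovesSquare (wordRel (c ⊔ d))) :
    (MovesLast (wordRel c) ∨ MovesSquare (wordRel c)) ∨
      (MovesLast (wordRel d) ∨ MovesSquare (wordRel d)) := by
  by_contra! hn
  have key : ∀ m, wordRel (c ⊔ d) [0, 0, 1] m → m = [0, 0, 1] := fun _ =>
    sup_isoterm (fun _ => (isRRStable_wordRel hc).first_square_isoterm hn.1.1 hn.1.2)
      (fun _ => (isRRStable_wordRel hd).first_square_isoterm hn.2.1 hn.2.2)
  rcases h with h | h
  · simpa using key _ h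
  · simpa using key _ h

theorem min_powIndex_le_sup (hc : sigmaRR ≤ c) (hd : sigmaRR ≤ d) :
    min (powIndex (wordRel c)) (powIndex (wordRel d)) ≤ powIndex (wordRel (c ⊔ d)) := by
  by_contra! hn
  have := sup_isoterm
    (fun _ => (isRRStable_wordRel hc).replicate_isoterm (lt_of_lt_of_le hn (min_le_left _ _)))
    (fun _ => (isRRStable_wordRel hd).replicate_isoterm (lt_of_lt_of_le hn (min_le_right _ _)))
    ((isRRStable_wordRel (le_sup_of_le_left hc)).powIndex_spec 0)
  simpa using congrArg List.length this

theorem powIndex_inf_le (hc : sigmaRR ≤ c) (hd : sigmaRR ≤ d) :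
    powIndex (wordRel (c ⊓ d)) ≤ max (powIndex (wordRel c)) (powIndex (wordRel d)) := by
  have h := isRRStable_wordRel hc
  have h' := isRRStable_wordRel hd
  exact (isRRStable_wordRel (le_inf hc hd)).powIndex_le (a := 0) (wordRel_inf.2
    ⟨h.replicate_of_min_eq (h.powIndex_spec 0) (by omega),
      h'.replicate_of_min_eq (h'.powIndex_spec 0) (by omega)⟩)

end Sup

/-- In the distributive law for three properties any two of which imply the third, joins only need
to satisfy the disjunctions of pairs of properties. -/
theorem imp_of_pairwise {P₁ Q₁ R₁ P₂ Q₂ R₂ P₃ Q₃ R₃ P Q R : Prop}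
    (hPQ : (P₁ ∨ Q₁) ∨ (P₂ ∨ Q₂)) (hPR : (P₁ ∨ R₁) ∨ (P₂ ∨ R₂)) (hP : P₃)
    (hQ₁ : Q₁ → Q₃) (hR₁ : R₁ → R₃) (hP' : P₁ → P) (hQ' : Q₁ → Q) (hR' : R₁ → R)
    (hP₂ : P₂ → P₃ → P) (hQ₂ : Q₂ → Q₃ → Q) (hR₂ : R₂ → R₃ → R) (h₂ : Q₂ → R₂ → P₂)
    (h₃ : P₃ → Q₃ → R₃) (h₃' : P₃ → R₃ → Q₃) (h : Q → R → P) : P := by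
  grind

theorem sup_inf_le_of_le {c d e : FICon} (hc : sigmaRR ≤ c) (hd : sigmaRR ≤ d) (hce : c ≤ e) :
    (c ⊔ d) ⊓ e ≤ c ⊔ d ⊓ e := by
  have he := hc.trans hce
  have hde := le_inf hd he
  have sd := isRRStable_wordRel hd
  have se := isRRStable_wordRel he
  have sg := isRRStable_wordRel (le_sup_of_le_left hc : sigmaRR ≤ c ⊔ d ⊓ e)
  have sl := isRRStable_wordRel (le_inf (le_sup_of_le_left hc) he : sigmaRR ≤ (c ⊔ d) ⊓ e)
  have hcg : ∀ l m, wordRel c l m → wordRel (c ⊔ d ⊓ e) l m :=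
    wordRel_le_wordRel.2 le_sup_left
  have hdg : ∀ l m, wordRel d l m → wordRel e l m → wordRel (c ⊔ d ⊓ e) l m :=
    fun l m h h' => wordRel_le_wordRel.2 le_sup_right l m (wordRel_inf.2 ⟨h, h'⟩)
  have hce' : ∀ l m, wordRel c l m → wordRel e l m := wordRel_le_wordRel.2 hce
  refine wordRel_le_wordRel.1 (sl.le_of_imp sg (fun h => ?_) (fun h => ?_) (fun h => ?_) ?_
    fun h => ?_)
  · obtain ⟨h, h'⟩ := wordRel_inf.1 h
    exact imp_of_pairwise (movesFirst_or_movesLast_of_sup hc hd (Or.inl h))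
      (movesFirst_or_movesSquare_of_sup hc hd (Or.inl h)) h' (hce' _ _) (hce' _ _) (hcg _ _)
      (hcg _ _) (hcg _ _) (hdg _ _) (hdg _ _) (hdg _ _) sd.movesFirst_of_movesLast_of_movesSquare
      se.movesSquare_of_movesFirst_of_movesLast se.movesLast_of_movesFirst_of_movesSquare
      sg.movesFirst_of_movesLast_of_movesSquare
  · obtain ⟨h, h'⟩ := wordRel_inf.1 h
    exact imp_of_pairwise ((movesFirst_or_movesLast_of_sup hc hd (Or.inr h)).imp Or.symm Or.symm)
      (movesLast_or_movesSquare_of_sup hc hd (Or.inl h)) h' (hce' _ _) (hce' _ _) (hcg _ _)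
      (hcg _ _) (hcg _ _) (hdg _ _) (hdg _ _) (hdg _ _) sd.movesLast_of_movesFirst_of_movesSquare
      (fun a b => se.movesSquare_of_movesFirst_of_movesLast b a)
      se.movesFirst_of_movesLast_of_movesSquare
      sg.movesLast_of_movesFirst_of_movesSquare
  · obtain ⟨h, h'⟩ := wordRel_inf.1 h
    exact imp_of_pairwise
      ((movesFirst_or_movesSquare_of_sup hc hd (Or.inr h)).imp Or.symm Or.symm)
      ((movesLast_or_movesSquare_of_sup hc hd (Or.inr h)).imp Or.symm Or.symm) h' (hce' _ _)
      (hce' _ _) (hcg _ _) (hcg _ _) (hcg _ _) (hdg _ _) (hdg _ _) (hdg _ _)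
      sd.movesSquare_of_movesFirst_of_movesLast
      (fun a b => se.movesLast_of_movesFirst_of_movesSquare b a)
      (fun a b => se.movesFirst_of_movesLast_of_movesSquare b a)
      sg.movesSquare_of_movesFirst_of_movesLast
  · have i1 := min_powIndex_le_sup hc hd
    have i2 := powIndex_inf_le hd he
    have i3 := (isRRStable_wordRel hc).powIndex_anti sg (wordRel_le_wordRel.2 le_sup_left)
    have i4 := (isRRStable_wordRel hde).powIndex_anti sg (wordRel_le_wordRel.2 le_sup_right)
    have i5 := sl.powIndex_anti (isRRStable_wordRel (le_sup_of_le_left hc))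
      (wordRel_le_wordRel.2 inf_le_left)
    have i6 := sl.powIndex_anti se (wordRel_le_wordRel.2 inf_le_right)
    have i7 := (isRRStable_wordRel hc).powIndex_anti se (wordRel_le_wordRel.2 hce)
    omega
  · obtain ⟨hsup, he⟩ := wordRel_inf.1 h
    exact (commutes_sup hc hd hsup).elim (hcg _ _) fun hd => hdg _ _ hd he

/-! ### Failure of distributivity -/

theorem append_eq_of_length_three {p q A B C : List ℕ} {i j k : ℕ} (hA : A ≠ []) (hB : B ≠ [])
    (hC : C ≠ []) (h : p ++ (A ++ (B ++ C)) ++ q = [i, j, k]) : A = [i] ∧ B = [j] ∧ C = [k] := by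
  have h1 := List.length_pos_iff.2 hA
  have h2 := List.length_pos_iff.2 hB
  have h3 := List.length_pos_iff.2 hC
  have h4 := congrArg List.length h
  simp only [List.length_append, List.length_cons, List.length_nil] at h4
  obtain rfl : p = [] := List.length_eq_zero_iff.1 (by omega)
  obtain rfl : q = [] := List.length_eq_zero_iff.1 (by omega)
  obtain ⟨a, rfl⟩ := List.length_eq_one_iff.1 (by omega : A.length = 1)
  obtain ⟨b, rfl⟩ := List.length_eq_one_iff.1 (by omega : B.length = 1)
  obtain ⟨c, rfl⟩ := List.length_eq_one_iff.1 (by omega : C.length = 1)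
  simpa using h

theorem sigmaRR_le_isotermCon {w : List ℕ} (hw : w.length = 3) (hw' : ∀ a, w.count a ≤ 2) :
    sigmaRR ≤ isotermCon w := by
  have hcount : ∀ X l : F, X ≠ 1 → (∀ a, 3 * X.toList.count a ≤ l.toList.count a) →
      l ≠ ofList w := by
    intro X l hX hl hlw
    obtain ⟨a, ha⟩ := List.exists_mem_of_ne_nil X.toList hX
    have h1 := List.count_pos_iff.2 ha
    have h2 := hl a
    have h3 := hw' a
    rw [hlw, FreeMonoid.toList_ofList] at h2
    omega
  have hlen : ∀ X Y l : F, X ≠ 1 → Y ≠ 1 →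
      2 * X.toList.length + 2 * Y.toList.length ≤ l.toList.length → l ≠ ofList w := by
    intro X Y l hX hY hl hlw
    have h1 : 0 < X.toList.length := List.length_pos_iff.2 hX
    have h2 : 0 < Y.toList.length := List.length_pos_iff.2 hY
    rw [hlw, FreeMonoid.toList_ofList] at hl
    omega
  refine fic_le_iff.2 ?_
  simp only [Set.mem_insert_iff, Set.mem_singleton_iff, forall_eq_or_imp, forall_eq]
  refine ⟨fun ξ p q => ?_, fun ξ p q => ?_, fun ξ p q => ?_, fun ξ p q => ?_, fun ξ p q => ?_⟩
  all_goals
    simp only [map_mul, pow_succ, pow_zero, one_mul]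
    by_cases hX : ξ x = 1
    · simp only [hX, one_mul, mul_one]
  iterate 2
    refine iff_of_false (hcount _ _ hX fun a => ?_) (hcount _ _ hX fun a => ?_) <;>
    · simp only [FreeMonoid.toList_mul, List.count_append]
      omega
  all_goals
    by_cases hY : ξ y = 1
    · simp only [hY, one_mul, mul_one]
    refine iff_of_false (hlen _ _ _ hX hY ?_) (hlen _ _ _ hX hY ?_) <;>
    · simp only [FreeMonoid.toList_mul, List.length_append]
      omega

theorem sigmaRR_le_isotermCon_three {i j k : ℕ} (h : ¬ (i = j ∧ j = k)) :
    sigmaRR ≤ isotermCon [i, j, k] := by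
  refine sigmaRR_le_isotermCon rfl fun a => ?_
  simp only [List.count_cons, List.count_nil, beq_iff_eq]
  split_ifs <;> omega

theorem wordRel_isotermCon_of_flatMap {w l m : List ℕ}
    (h : ∀ (f : ℕ → List ℕ) (p q : List ℕ),
      p ++ l.flatMap f ++ q = w ↔ p ++ m.flatMap f ++ q = w) :
    wordRel (isotermCon w) l m := by
  intro ξ p q
  have h1 := h (fun n => (ξ (FreeMonoid.of n)).toList) p.toList q.toList
  have h2 : ξ = FreeMonoid.lift fun n => ofList (ξ (FreeMonoid.of n)).toList :=
    (FreeMonoid.lift_restrict ξ).symm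
  rw [h2, lift_ofList_eq, lift_ofList_eq]
  exact h1

theorem wordRel_isotermCon {l m : List ℕ} {i j k : ℕ}
    (h : ∀ f : ℕ → List ℕ, f 0 = [] ∨ f 1 = [] → l.flatMap f = m.flatMap f)
    (hl : ∀ f : ℕ → List ℕ, f 0 ≠ [] → f 1 ≠ [] → ∀ p q, p ++ l.flatMap f ++ q ≠ [i, j, k])
    (hm : ∀ f : ℕ → List ℕ, f 0 ≠ [] → f 1 ≠ [] → ∀ p q, p ++ m.flatMap f ++ q ≠ [i, j, k]) :
    wordRel (isotermCon [i, j, k]) l m := by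
  refine wordRel_isotermCon_of_flatMap fun f p q => ?_
  by_cases h0 : f 0 = []
  · rw [h f (Or.inl h0)]
  by_cases h1 : f 1 = []
  · rw [h f (Or.inr h1)]
  exact iff_of_false (hl f h0 h1 p q) (hm f h0 h1 p q)

theorem movesFirst_isotermCon : MovesFirst (wordRel (isotermCon [0, 0, 1])) := by
  refine wordRel_isotermCon ?_ ?_ ?_
  · rintro f (h | h) <;> simp [h]
  all_goals
    intro f h0 h1 p q e
    simp only [List.flatMap_cons, List.flatMap_nil, List.append_nil] at e
    have := append_eq_of_length_three (by assumption) (by assumption) (by assumption) e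
    grind

theorem movesLast_isotermCon : MovesLast (wordRel (isotermCon [1, 0, 0])) := by
  refine wordRel_isotermCon ?_ ?_ ?_
  · rintro f (h | h) <;> simp [h]
  all_goals
    intro f h0 h1 p q e
    simp only [List.flatMap_cons, List.flatMap_nil, List.append_nil] at e
    have := append_eq_of_length_three (by assumption) (by assumption) (by assumption) e
    grind

theorem movesSquare_isotermCon : MovesSquare (wordRel (isotermCon [0, 1, 0])) := by
  refine wordRel_isotermCon ?_ ?_ ?_
  · rintro f (h | h) <;> simp [h]
  all_goals
    intro f h0 h1 p q e
    simp only [List.flatMap_cons, List.flatMap_nil, List.append_nil] at e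
    have := append_eq_of_length_three (by assumption) (by assumption) (by assumption) e
    grind

theorem not_inf_sup_le : ¬ isotermCon [0, 0, 1] ⊓ (isotermCon [1, 0, 0] ⊔ isotermCon [0, 1, 0]) ≤
    (isotermCon [0, 0, 1] ⊓ isotermCon [1, 0, 0]) ⊔
      (isotermCon [0, 0, 1] ⊓ isotermCon [0, 1, 0]) := by
  intro hle
  have ha : sigmaRR ≤ isotermCon [0, 0, 1] := sigmaRR_le_isotermCon_three (by decide)
  have hb : sigmaRR ≤ isotermCon [1, 0, 0] := sigmaRR_le_isotermCon_three (by decide)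
  have hc : sigmaRR ≤ isotermCon [0, 1, 0] := sigmaRR_le_isotermCon_three (by decide)
  have h1 : MovesFirst (wordRel (isotermCon [1, 0, 0] ⊔ isotermCon [0, 1, 0])) :=
    (isRRStable_wordRel (le_sup_of_le_left hb)).movesFirst_of_movesLast_of_movesSquare
      (wordRel_le_wordRel.2 le_sup_left _ _ movesLast_isotermCon)
      (wordRel_le_wordRel.2 le_sup_right _ _ movesSquare_isotermCon)
  have h2 := movesFirst_or_movesSquare_of_sup (le_inf ha hb) (le_inf ha hc)
    (Or.inl (hle (wordRel_inf.2 ⟨movesFirst_isotermCon, h1⟩)))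
  have hb' : ∀ m, wordRel (isotermCon [1, 0, 0]) m [1, 0, 0] → m = [1, 0, 0] :=
    fun m h => isotermCon_isoterm ((isotermCon [1, 0, 0]).1.symm h)
  rcases h2 with (h | h) | (h | h)
  · simpa using hb' _ (wordRel_inf.1 h).2
  · simpa using hb' _ (wordRel_inf.1 h).2
  · simpa using isotermCon_isoterm (wordRel_inf.1 h).2
  · simpa using isotermCon_isoterm (wordRel_inf.1 h).1

/-- The interval `[σ_RRδ, ⊤]` of the lattice of fully invariant congruences
on `F` (equivalently, the subvariety lattice of the monoid variety
`R ∨ R^δ`) is a modular lattice but not a distributive one. -/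
theorem interval_modular_not_distributive :
    IsModularLattice (Set.Icc sigmaRR (⊤ : FICon)) ∧
      ¬ (∀ a b c : Set.Icc sigmaRR (⊤ : FICon), a ⊓ (b ⊔ c) ≤ (a ⊓ b) ⊔ (a ⊓ c)) := by
  refine ⟨⟨fun {a} b c hac => sup_inf_le_of_le a.2.1 b.2.1 hac⟩, fun h => ?_⟩
  exact not_inf_sup_le (h
    ⟨isotermCon [0, 0, 1], sigmaRR_le_isotermCon_three (by decide), le_top⟩
    ⟨isotermCon [1, 0, 0], sigmaRR_le_isotermCon_three (by decide), le_top⟩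
    ⟨isotermCon [0, 1, 0], sigmaRR_le_isotermCon_three (by decide), le_top⟩)
end

section
/- The interval [σ_RRδ, ⊤] of the lattice 𝓛 of fully invariant congruences on F contains exactly 11 elements. (Equivalently: the monoid variety R ∨ R^δ has exactly 11 subvarieties.) -/
namespace WordIdentity

variable {M : Type*} [Monoid M] {N : Type*} [Monoid N]

/-- The value of a word under an assignment of its letters. -/
def ev (g : ℕ → M) (w : List ℕ) : M := (w.map g).prod

@[simp] lemma ev_nil (g : ℕ → M) : ev g [] = 1 := rfl

@[simp] lemma ev_cons (g : ℕ → M) (a : ℕ) (w : List ℕ) : ev g (a :: w) = g a * ev g w := by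
  simp [ev]

@[simp] lemma ev_append (g : ℕ → M) (u v : List ℕ) : ev g (u ++ v) = ev g u * ev g v := by
  simp [ev]

lemma ev_replicate (g : ℕ → M) (k a : ℕ) : ev g (List.replicate k a) = g a ^ k := by
  simp [ev]

/-- The monoid `M` satisfies the identity `u ≈ v`. -/
def Ident (M : Type*) [Monoid M] (u v : List ℕ) : Prop := ∀ g : ℕ → M, ev g u = ev g v

/-- The monoid `M` satisfies the identities defining `sigmaRR`. -/
structure Sat (M : Type*) [Monoid M] : Prop where
  pow_four : ∀ a : M, a ^ 4 = a ^ 3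
  cube : ∀ a b c d : M, a ^ 3 * b * c * d = b * a * c * a * d * a
  first_first : ∀ a b c d : M, a * b * c * a * d * b = b * a * c * a * d * b
  second_first : ∀ a b c d : M, a * c * a * b * d * b = a * c * b * a * d * b
  second_second : ∀ a b c d : M, a * d * b * c * a * b = a * d * b * c * b * a

def Comm (M : Type*) [Monoid M] : Prop := ∀ a b : M, a * b = b * a

/-- The identity `x²y ≈ xyx`. -/
def LeftSq (M : Type*) [Monoid M] : Prop := ∀ a b : M, a * a * b = a * b * a

/-- The identity `xyx ≈ yx²`. -/
def RightSq (M : Type*) [Monoid M] : Prop := ∀ a b : M, a * b * a = b * a * a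

/-- The identity `x²y ≈ yx²`. -/
def CentralSq (M : Type*) [Monoid M] : Prop := ∀ a b : M, a * a * b = b * a * a

lemma Sat.pow_ge (h : Sat M) (a : M) {k : ℕ} (hk : 3 ≤ k) : a ^ k = a ^ 3 := by
  induction k, hk using Nat.le_induction with
  | base => rfl
  | succ n _ ih => rw [pow_succ, ih, ← pow_succ, h.pow_four]

lemma Sat.cube_comm (h : Sat M) (a b : M) : a ^ 3 * b = b * a ^ 3 := by
  have k := h.cube a b 1 1
  simpa [mul_assoc, pow_succ] using k

lemma Sat.cube_gather (h : Sat M) (a b c : M) : a * b * a * c * a = a ^ 3 * b * c := by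
  have k := h.cube a 1 b c
  simpa using k.symm

lemma Sat.conj_pow (h : Sat M) (a b : M) {m n : ℕ} (hmn : 3 ≤ m + n) :
    a ^ m * b * a ^ n = a ^ 3 * b := by
  have e : a ^ 2 * b * a = a ^ 3 * b := by
    have k := h.cube a 1 1 b
    simpa [pow_succ] using k.symm
  have e' : a * b * a ^ 2 = a ^ 3 * b := by
    have k := h.cube a 1 b 1
    simpa [pow_succ, mul_assoc] using k.symm
  rcases m with _ | _ | _ | m
  · rw [h.pow_ge a (by omega : 3 ≤ n), h.cube_comm]; simp
  · rcases n with _ | _ | n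
    · omega
    · omega
    · rcases n with _ | n
      · simpa using e'
      · rw [h.pow_ge a (by omega : 3 ≤ n + 1 + 1 + 1), mul_assoc, ← h.cube_comm, ← mul_assoc,
          ← pow_add, h.pow_ge a (by omega)]
  · rcases n with _ | _ | n
    · omega
    · simpa using e
    · rw [pow_succ' a (n + 1), ← mul_assoc, e, h.cube_comm, mul_assoc, ← pow_add,
        h.pow_ge a (by omega)]
  · rw [h.pow_ge a (by omega : 3 ≤ m + 1 + 1 + 1), h.cube_comm, mul_assoc, ← pow_add,
      h.pow_ge a (by omega)]

lemma leftSq_of_comm (h : Comm M) : LeftSq M := fun a b => by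
  rw [mul_assoc, mul_assoc, h a b]

lemma RightSq.leftSq (h : RightSq M) (h' : CentralSq M) : LeftSq M :=
  fun a b => (h' a b).trans (h a b).symm

lemma LeftSq.rightSq (h : LeftSq M) (h' : CentralSq M) : RightSq M :=
  fun a b => (h a b).symm.trans (h' a b)

lemma LeftSq.centralSq (h : LeftSq M) (h' : RightSq M) : CentralSq M :=
  fun a b => (h a b).trans (h' a b)

lemma Sat.centralSq (h : Sat M) (h' : ∀ a : M, a ^ 2 = a ^ 3) : CentralSq M := fun a b => by
  rw [mul_assoc b, ← sq, h', h.cube_comm]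

lemma Sat.comm (h : Sat M) {m : ℕ} (hm : 1 ≤ m) (h' : ∀ a : M, a = a ^ (m + 1)) : Comm M := by
  have e : ∀ a : M, a = a ^ 3 := fun a => by
    have : a = a ^ (m + 1 + m) := by
      rw [pow_add, ← h' a, ← pow_succ', ← h' a]
    rw [h.pow_ge a (by omega)] at this
    exact this
  intro a b
  rw [e a, h.cube_comm]

/-- A condition under which the adjacent letters `c`, `a` in `p ++ c :: a :: r` may be swapped. -/
lemma Sat.ev_swap (h : Sat M) (g : ℕ → M) (p r : List ℕ) (a c : ℕ)
    (H : a = c ∨ ((a ∈ p ∨ a ∈ r) ∧ (c ∈ p ∨ c ∈ r)) ∨ (LeftSq M ∧ (c ∈ p ∨ a ∈ p)) ∨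
      (RightSq M ∧ (c ∈ r ∨ a ∈ r))) :
    ev g (p ++ c :: a :: r) = ev g (p ++ a :: c :: r) := by
  have left : ∀ (_ : LeftSq M) (A B Z : M), A * Z * A * B = A * Z * B * A := fun hl A B Z => by
    rw [← hl, mul_assoc A Z B, ← hl]; simp only [mul_assoc]
  have right : ∀ (_ : RightSq M) (A B Z : M), A * B * Z * A = B * A * Z * A := fun hr A B Z => by
    have k := hr A (B * Z)
    have k' := hr A Z
    simp only [mul_assoc] at k k' ⊢
    rw [k, k']
  rcases H with rfl | ⟨ha | ha, hc | hc⟩ | ⟨hl, hc | ha⟩ | ⟨hr, hc | ha⟩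
  · rfl
  · obtain ⟨p₁, p₂, rfl⟩ := List.append_of_mem ha
    rcases List.mem_append.1 hc with hc | hc
    · obtain ⟨q₁, q₂, rfl⟩ := List.append_of_mem hc
      have k := congrArg (fun m => ev g q₁ * m * ev g r)
        (h.second_second (g c) (g a) (ev g p₂) (ev g q₂))
      simpa [mul_assoc] using k
    · rcases List.mem_cons.1 hc with rfl | hc
      · rfl
      obtain ⟨q₁, q₂, rfl⟩ := List.append_of_mem hc
      have k := congrArg (fun m => ev g p₁ * m * ev g r)
        (h.second_second (g a) (g c) (ev g q₂) (ev g q₁))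
      simpa [mul_assoc] using k.symm
  · obtain ⟨p₁, p₂, rfl⟩ := List.append_of_mem ha
    obtain ⟨q₁, q₂, rfl⟩ := List.append_of_mem hc
    have k := congrArg (fun m => ev g p₁ * m * ev g q₂)
      (h.second_first (g a) (g c) (ev g p₂) (ev g q₁))
    simpa [mul_assoc] using k.symm
  · obtain ⟨p₁, p₂, rfl⟩ := List.append_of_mem hc
    obtain ⟨q₁, q₂, rfl⟩ := List.append_of_mem ha
    have k := congrArg (fun m => ev g p₁ * m * ev g q₂)
      (h.second_first (g c) (g a) (ev g p₂) (ev g q₁))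
    simpa [mul_assoc] using k
  · obtain ⟨p₁, p₂, rfl⟩ := List.append_of_mem ha
    rcases List.mem_append.1 hc with hc | hc
    · obtain ⟨q₁, q₂, rfl⟩ := List.append_of_mem hc
      have k := congrArg (fun m => ev g p * m * ev g p₂)
        (h.first_first (g c) (g a) (ev g q₁) (ev g q₂))
      simpa [mul_assoc] using k
    · rcases List.mem_cons.1 hc with rfl | hc
      · rfl
      obtain ⟨q₁, q₂, rfl⟩ := List.append_of_mem hc
      have k := congrArg (fun m => ev g p * m * ev g q₂)
        (h.first_first (g a) (g c) (ev g p₁) (ev g q₁))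
      simpa [mul_assoc] using k.symm
  · obtain ⟨q₁, q₂, rfl⟩ := List.append_of_mem hc
    have k := congrArg (fun m => ev g q₁ * m * ev g r) (left hl (g c) (g a) (ev g q₂))
    simpa [mul_assoc] using k
  · obtain ⟨q₁, q₂, rfl⟩ := List.append_of_mem ha
    have k := congrArg (fun m => ev g q₁ * m * ev g r) (left hl (g a) (g c) (ev g q₂))
    simpa [mul_assoc] using k.symm
  · obtain ⟨q₁, q₂, rfl⟩ := List.append_of_mem hc
    have k := congrArg (fun m => ev g p * m * ev g q₂) (right hr (g c) (g a) (ev g q₁))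
    simpa [mul_assoc] using k
  · obtain ⟨q₁, q₂, rfl⟩ := List.append_of_mem ha
    have k := congrArg (fun m => ev g p * m * ev g q₂) (right hr (g a) (g c) (ev g q₁))
    simpa [mul_assoc] using k.symm

lemma mem_of_two_le_count {a c : ℕ} {p r : List ℕ} (h : 2 ≤ (p ++ c :: a :: r).count a)
    (hac : a ≠ c) : a ∈ p ∨ a ∈ r := by
  by_contra! hn
  simp [List.count_eq_zero.2 hn.1, List.count_eq_zero.2 hn.2, hac.symm] at h

lemma Sat.ev_move (h : Sat M) (g : ℕ → M) (a : ℕ) (r s p : List ℕ)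
    (H : ∀ c ∈ s, a = c ∨ (2 ≤ (p ++ s ++ a :: r).count a ∧ 2 ≤ (p ++ s ++ a :: r).count c) ∨
      (LeftSq M ∧ (c ∈ p ∨ a ∈ p)) ∨ (RightSq M ∧ (c ∈ r ∨ a ∈ r))) :
    ev g (p ++ s ++ a :: r) = ev g (p ++ a :: (s ++ r)) := by
  induction s generalizing p with
  | nil => simp
  | cons c s ih =>
    have e : p ++ c :: s ++ a :: r = (p ++ [c]) ++ s ++ a :: r := by simp
    rw [e, ih (p ++ [c])]
    · have := h.ev_swap g p (s ++ r) a c ?_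
      · simpa using this
      rcases H c (by simp) with H | ⟨H₁, H₂⟩ | ⟨H₁, H₂⟩ | ⟨H₁, H₂⟩
      · exact Or.inl H
      · by_cases hac : a = c
        · exact Or.inl hac
        right; left
        constructor
        · apply mem_of_two_le_count (c := c) _ hac
          simp only [List.count_append, List.count_cons] at H₁ ⊢
          omega
        · apply mem_of_two_le_count (c := a) _ (Ne.symm hac)
          simp only [List.count_append, List.count_cons] at H₂ ⊢
          omega
      · exact Or.inr (Or.inr (Or.inl ⟨H₁, H₂⟩))
      · refine Or.inr (Or.inr (Or.inr ⟨H₁, ?_⟩))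
        simp only [List.mem_append]; tauto
    · intro d hd
      rw [← e]
      rcases H d (by simp [hd]) with H | H | ⟨H₁, H₂⟩ | H
      · exact Or.inl H
      · exact Or.inr (Or.inl H)
      · refine Or.inr (Or.inr (Or.inl ⟨H₁, ?_⟩))
        simp only [List.mem_append]; tauto
      · exact Or.inr (Or.inr (Or.inr H))

/-- The number of occurrences of `a` before the first occurrence of `d` in `w`. -/
def before (a d : ℕ) (w : List ℕ) : ℕ := (w.takeWhile (· ≠ d)).count a

lemma takeWhile_split {d : ℕ} {w₁ w₂ : List ℕ} (h : d ∉ w₁) :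
    (w₁ ++ d :: w₂).takeWhile (· ≠ d) = w₁ := by
  induction w₁ with
  | nil => simp
  | cons b w ih =>
    simp only [List.mem_cons, not_or] at h
    simp only [List.cons_append, List.takeWhile_cons, ih h.2]
    simp [Ne.symm h.1]

lemma before_split (a : ℕ) {d : ℕ} {w₁ w₂ : List ℕ} (h : d ∉ w₁) :
    before a d (w₁ ++ d :: w₂) = w₁.count a := by
  rw [before, takeWhile_split h]

lemma before_le_count (a d : ℕ) (w : List ℕ) : before a d w ≤ w.count a :=
  (List.takeWhile_sublist _).count_le a

lemma exists_split {d : ℕ} {w : List ℕ} (h : w.count d = 1) :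
    ∃ w₁ w₂, w = w₁ ++ d :: w₂ ∧ d ∉ w₁ ∧ d ∉ w₂ := by
  obtain ⟨w₁, w₂, rfl⟩ := List.append_of_mem (List.count_pos_iff.1 (by omega : 0 < w.count d))
  refine ⟨w₁, w₂, rfl, ?_, ?_⟩ <;> rw [← List.count_eq_zero] <;> simp at h <;> omega

lemma before_mono_of_pos {a d : ℕ} {w : List ℕ} (c : ℕ) (h : 0 < before a d w) :
    before c a w ≤ before c d w := by
  induction w with
  | nil => simp [before]
  | cons b w ih =>
    simp only [before, List.takeWhile_cons] at h ih ⊢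
    by_cases hb : b = d
    · simp [hb] at h
    · by_cases ha : b = a
      · simp [ha]
      · simp only [ne_eq, hb, ha, not_false_eq_true, decide_true, ↓reduceIte, List.count_cons]
          at h ih ⊢
        have := ih (by simpa [ha] using h)
        omega

lemma before_mono_of_eq_zero {a d : ℕ} {w : List ℕ} (c : ℕ) (h : before a d w = 0) :
    before c d w ≤ before c a w := by
  induction w with
  | nil => simp [before]
  | cons b w ih =>
    simp only [before, List.takeWhile_cons] at h ih ⊢
    by_cases hb : b = d
    · simp [hb]
    · by_cases ha : b = a
      · subst ha; simp [hb] at h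
      · simp only [ne_eq, hb, ha, not_false_eq_true, decide_true, ↓reduceIte, List.count_cons]
          at h ih ⊢
        have := ih (by simpa [ha] using h)
        omega

lemma ev_filter (g : ℕ → M) (S : ℕ → Bool) (w : List ℕ) :
    ev g (w.filter S) = ev (fun i => if S i then g i else 1) w := by
  induction w with
  | nil => rfl
  | cons b w ih => by_cases h : S b <;> simp [h, ih]

lemma Ident.filter {u v : List ℕ} (h : Ident M u v) (S : ℕ → Bool) :
    Ident M (u.filter S) (v.filter S) := fun g => by
  rw [ev_filter, ev_filter, h]

/-- The assignment sending `i` to `a`, `d` to `b` and every other letter to `1`. -/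
def assign (i d : ℕ) (a b : M) : ℕ → M := fun j => if j = i then a else if j = d then b else 1

lemma ev_assign_of_notMem (i d : ℕ) (a b : M) {w : List ℕ} (hd : d ∉ w) :
    ev (assign i d a b) w = a ^ w.count i := by
  induction w with
  | nil => simp
  | cons c w ih =>
    simp only [List.mem_cons, not_or] at hd
    rw [ev_cons, ih hd.2, assign, List.count_cons]
    by_cases hc : c = i
    · simp [hc, pow_succ']
    · simp [hc, Ne.symm hd.1]

lemma ev_assign {i d : ℕ} (hid : i ≠ d) (a b : M) {w : List ℕ} (hd : w.count d = 1) :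
    ev (assign i d a b) w = a ^ before i d w * b * a ^ (w.count i - before i d w) := by
  obtain ⟨w₁, w₂, rfl, h₁, h₂⟩ := exists_split hd
  rw [before_split _ h₁, ev_append, ev_cons, ev_assign_of_notMem _ _ _ _ h₁,
    ev_assign_of_notMem _ _ _ _ h₂, List.count_append, List.count_cons_of_ne hid.symm]
  simp [assign, hid.symm, mul_assoc]

lemma Ident.pow {u v : List ℕ} (h : Ident M u v) (i : ℕ) (a : M) :
    a ^ u.count i = a ^ v.count i := by
  have e : ∀ w : List ℕ, ev (fun j => if j = i then a else 1) w = a ^ w.count i := fun w => by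
    induction w with
    | nil => simp
    | cons c w ih =>
      rw [ev_cons, ih, List.count_cons]
      by_cases hc : c = i <;> simp [hc, pow_succ']
  rw [← e, ← e, h]

lemma Ident.conj {u v : List ℕ} (h : Ident M u v) {i d : ℕ} (hid : i ≠ d) (hu : u.count d = 1)
    (hv : v.count d = 1) (a b : M) :
    a ^ before i d u * b * a ^ (u.count i - before i d u) =
      a ^ before i d v * b * a ^ (v.count i - before i d v) := by
  rw [← ev_assign hid a b hu, ← ev_assign hid a b hv, h]

lemma Ident.before_eq (hc : ¬ Comm M) {u v : List ℕ} (h : Ident M u v) {i d : ℕ} (hid : i ≠ d)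
    (hu : u.count d = 1) (hv : v.count d = 1) (hu' : u.count i = 1) (hv' : v.count i = 1) :
    before i d u = before i d v := by
  have k := h.conj hid hu hv
  have h₁ := before_le_count i d u
  have h₂ := before_le_count i d v
  rw [hu', hv'] at *
  by_contra hne
  apply hc
  intro a b
  have k := k a b
  generalize before i d u = m at *
  generalize before i d v = n at *
  interval_cases m <;> interval_cases n <;> simp_all

lemma Ident.before_cases {u v : List ℕ} (h : Ident M u v) {i d : ℕ} (hid : i ≠ d)
    (hu : u.count d = 1) (hv : v.count d = 1) (hu' : u.count i = 2) (hv' : v.count i = 2) :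
    before i d u = before i d v ∨ (LeftSq M ∧ 1 ≤ before i d u ∧ 1 ≤ before i d v) ∨
      (RightSq M ∧ before i d u ≤ 1 ∧ before i d v ≤ 1) ∨
      (CentralSq M ∧ (before i d u = 2 ∧ before i d v = 0 ∨
        before i d u = 0 ∧ before i d v = 2)) := by
  have k := h.conj hid hu hv
  have h₁ := before_le_count i d u
  have h₂ := before_le_count i d v
  rw [hu', hv'] at *
  generalize before i d u = m at *
  generalize before i d v = n at *
  interval_cases m <;> interval_cases n <;> simp [sq, ← mul_assoc] at k ⊢
  all_goals first
    | (intro a b; exact k a b)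
    | (intro a b; exact (k a b).symm)

/-- All occurrences of `i` in `u` may be moved to the front. -/
def Gather (M : Type*) [Monoid M] (u : List ℕ) (i : ℕ) : Prop :=
  Ident M u (List.replicate (u.count i) i ++ u.filter (· ≠ i))

lemma gather_iff {u : List ℕ} {i : ℕ} :
    Gather M u i ↔ ∀ g : ℕ → M, ev g u = g i ^ u.count i * ev g (u.filter (· ≠ i)) := by
  simp [Gather, Ident, ev_replicate]

lemma Comm.gather (h : Comm M) (u : List ℕ) (i : ℕ) : Gather M u i := by
  rw [gather_iff]
  intro g
  induction u with
  | nil => simp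
  | cons c w ih =>
    rw [ev_cons, ih, List.count_cons]
    by_cases hc : c = i
    · simp [hc, pow_succ', mul_assoc]
    · simp [hc, ← mul_assoc, h (g c)]

lemma Sat.cube_ev (h : Sat M) (g : ℕ → M) (i : ℕ) (w : List ℕ) :
    g i ^ 3 * ev g w = g i ^ 3 * ev g (w.filter (· ≠ i)) := by
  induction w with
  | nil => simp
  | cons c w ih =>
    by_cases hc : c = i
    · simp only [ev_cons, hc, ← mul_assoc, ← pow_succ, h.pow_four]
      simpa using ih
    · simp only [ev_cons, ne_eq, hc, not_false_eq_true, decide_true, List.filter_cons_of_pos]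
      rw [← mul_assoc, h.cube_comm, mul_assoc, ih, ← mul_assoc, ← h.cube_comm, mul_assoc]

lemma Sat.gather_of_three_le (h : Sat M) {u : List ℕ} {i : ℕ} (hu : 3 ≤ u.count i) :
    Gather M u i := by
  rw [gather_iff]
  intro g
  rw [h.pow_ge _ hu, ← h.cube_ev]
  obtain ⟨p, q, rfl, hp⟩ := List.eq_append_cons_of_mem (List.count_pos_iff.1 (by omega : 0 < u.count i))
  simp only [List.count_append, List.count_eq_zero.2 hp, List.count_cons_self] at hu
  obtain ⟨q, r, rfl, hq⟩ := List.eq_append_cons_of_mem (List.count_pos_iff.1 (by omega : 0 < q.count i))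
  simp only [List.count_append, List.count_eq_zero.2 hq, List.count_cons_self] at hu
  obtain ⟨r, s, rfl⟩ := List.append_of_mem (List.count_pos_iff.1 (by omega : 0 < r.count i))
  have k := h.cube_gather (g i) (ev g q) (ev g r)
  have k' : ∀ a b : M, g i ^ 3 * (a * (g i * b)) = g i ^ 3 * (a * b) := fun a b => by
    rw [← mul_assoc, h.cube_comm, mul_assoc, ← mul_assoc (_ ^ 3), ← pow_succ, h.pow_four,
      ← mul_assoc a, h.cube_comm, mul_assoc, ← mul_assoc, ← h.cube_comm, mul_assoc, h.cube_comm]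
  simp only [ev_append, ev_cons]
  rw [k', ← mul_assoc (ev g p) (ev g q), k', ← mul_assoc (ev g p * ev g q), k']
  have k := congrArg (fun m => ev g p * m * ev g s) k
  simp only [mul_assoc] at k ⊢
  rw [k, ← mul_assoc, ← h.cube_comm, mul_assoc]

lemma Sat.gather_of_count_eq_two (h : Sat M) (hc : CentralSq M) {u : List ℕ} {i : ℕ}
    (hu : u.count i = 2) (hs : LeftSq M ∨ ∀ d, u.count d = 1 → before i d u ≠ 1) :
    Gather M u i := by
  rw [gather_iff]
  intro g
  rw [hu]
  obtain ⟨p, q, rfl, hp⟩ :=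
    List.eq_append_cons_of_mem (List.count_pos_iff.1 (by omega : 0 < u.count i))
  simp only [List.count_append, List.count_eq_zero.2 hp, List.count_cons_self] at hu
  obtain ⟨q, r, rfl, hq⟩ :=
    List.eq_append_cons_of_mem (List.count_pos_iff.1 (by omega : 0 < q.count i))
  simp only [List.count_append, List.count_eq_zero.2 hq, List.count_cons_self] at hu
  have hr : i ∉ r := by rw [← List.count_eq_zero]; omega
  have f : ∀ {w : List ℕ}, i ∉ w → w.filter (· ≠ i) = w := fun {w} hw => by
    rw [List.filter_eq_self]
    intro a ha
    simpa using fun e : a = i => hw (e ▸ ha)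
  have k := h.ev_move g i r q (p ++ [i]) ?_
  · simp only [List.append_assoc, List.cons_append, List.nil_append] at k
    rw [k]
    have k := congrArg (fun m => m * (ev g q * ev g r)) (hc (g i) (ev g p))
    simp only [List.filter_append, f hp, List.filter_cons, f hq, f hr]
    simpa [sq, mul_assoc] using k.symm
  · intro c hcq
    rcases hs with hs | hs
    · exact Or.inr (Or.inr (Or.inl ⟨hs, Or.inr (by simp)⟩))
    · have hci : c ≠ i := fun e => hq (e ▸ hcq)
      refine Or.inr (Or.inl ⟨by simp; omega, ?_⟩)
      have e : p ++ [i] ++ q ++ i :: r = p ++ i :: (q ++ i :: r) := by simp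
      rw [e]
      by_contra hlt
      have hpos : 0 < q.count c := List.count_pos_iff.2 hcq
      have h1 : (p ++ i :: (q ++ i :: r)).count c = 1 := by
        simp only [List.count_append, List.count_cons] at hlt ⊢
        omega
      refine hs c h1 ?_
      have e : ∃ q₁ q₂, q = q₁ ++ c :: q₂ := List.append_of_mem hcq
      obtain ⟨q₁, q₂, rfl⟩ := e
      have e : p ++ i :: (q₁ ++ c :: q₂ ++ i :: r) = (p ++ i :: q₁) ++ c :: (q₂ ++ i :: r) := by simp
      rw [e] at h1 ⊢
      rw [before_split]
      · simp only [List.mem_append, not_or] at hq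
        simp [List.count_eq_zero.2 hp, List.count_eq_zero.2 hq.1]
      · rw [← List.count_eq_zero]
        simp only [List.count_append, List.count_cons_self] at h1 ⊢
        omega

lemma Sat.pow_cases (h : Sat M) (hc : ¬ Comm M) {k l : ℕ} (hkl : k < l)
    (e : ∀ a : M, a ^ k = a ^ l) : 2 ≤ k ∧ (k = 2 → ∀ a : M, a ^ 2 = a ^ 3) := by
  rcases k with _ | _ | _ | k
  · refine (hc (h.comm (m := l) (by omega) fun a => ?_)).elim
    rw [pow_succ, ← e]; simp
  · refine (hc (h.comm (m := l - 1) (by omega) fun a => ?_)).elim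
    rw [Nat.sub_add_cancel (by omega), ← e]; simp
  · exact ⟨le_rfl, fun _ a => by simpa [h.pow_ge a hkl] using e a⟩
  · exact ⟨by omega, fun h => by omega⟩

/-- The identities of `M`, among those that matter, hold in `N`. -/
structure Transfer (M N : Type*) [Monoid M] [Monoid N] : Prop where
  one : (∀ a : M, 1 = a) → ∀ a : N, 1 = a
  sq : (∀ a : M, a = a * a) → ∀ a : N, a = a * a
  cube : (∀ a : M, a * a = a * a * a) → ∀ a : N, a * a = a * a * a
  comm : Comm M → Comm N
  left : LeftSq M → LeftSq N
  right : RightSq M → RightSq N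
  central : CentralSq M → CentralSq N

lemma Transfer.pow_of_lt (T : Transfer M N) (hM : Sat M) (hN : Sat N) {k l : ℕ} (hkl : k < l)
    (e : ∀ a : M, a ^ k = a ^ l) (b : N) : b ^ k = b ^ l := by
  rcases k with _ | _ | _ | k
  · have : ∀ a : M, 1 = a := fun a => by
      have e3 : a ^ 3 = 1 := by
        rw [← hM.pow_ge a (by omega : 3 ≤ l * 3), pow_mul, ← e]; simp
      have := hM.pow_four a
      rw [pow_succ, e3, one_mul] at this
      exact this.symm
    rw [← T.one this b]; simp
  · have : ∀ a : M, a = a * a := fun a => by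
      have e3 : a = a ^ 3 := by
        have : a = a ^ (l + (l - 1)) := by
          rw [pow_add, ← e, zero_add, ← pow_add, show 1 + (l - 1) = l by omega, ← e]; simp
        rwa [hM.pow_ge a (by omega)] at this
      rw [← pow_two]
      nth_rw 2 [e3]
      rw [← pow_mul, hM.pow_ge a (by norm_num), ← e3]
    have := T.sq this b
    have e' : ∀ n : ℕ, b ^ (n + 1) = b := fun n => by
      induction n with
      | zero => simp
      | succ n ih => rw [pow_succ, ih, ← this]
    obtain ⟨n, rfl⟩ : ∃ n, l = n + 1 := ⟨l - 1, by omega⟩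
    rw [e' n, e' 0]
  · have := T.cube (fun a => by
      have := e a
      rw [hM.pow_ge a (by omega : 3 ≤ l)] at this
      simpa [pow_succ] using this) b
    rw [hN.pow_ge b (by omega : 3 ≤ l)]
    simpa [pow_succ] using this
  · rw [hN.pow_ge b (by omega : 3 ≤ l), hN.pow_ge b (by omega)]

lemma Transfer.pow (T : Transfer M N) (hM : Sat M) (hN : Sat N) {k l : ℕ}
    (e : ∀ a : M, a ^ k = a ^ l) (b : N) : b ^ k = b ^ l := by
  rcases lt_trichotomy k l with hkl | rfl | hkl
  · exact T.pow_of_lt hM hN hkl e b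
  · rfl
  · exact (T.pow_of_lt hM hN hkl (fun a => (e a).symm) b).symm

/-- Two words whose letters occur at most twice, the second of which has no letter that could be
gathered, are compared by moving letters of the first into the places they have in the second. -/
lemma Transfer.ident_of_perm (T : Transfer M N) (hM : Sat M) (hN : Sat N) (hc : ¬ Comm M)
    {w : List ℕ} (h2 : ∀ i, w.count i ≤ 2)
    (hs : CentralSq M → ∀ i, w.count i = 2 →
      ¬ LeftSq M ∧ ∃ d, w.count d = 1 ∧ before i d w = 1)
    (v p u : List ℕ) (hw : w = p ++ v) (hperm : (p ++ u).Perm w) (h : Ident M (p ++ u) w) :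
    Ident N (p ++ u) w := by
  have cases : ∀ s : List ℕ, s.Perm w → Ident M s w → ∀ i d, i ≠ d → w.count i = 2 →
      w.count d = 1 → before i d s = before i d w ∨
      (LeftSq M ∧ 1 ≤ before i d s ∧ 1 ≤ before i d w) ∨
      (RightSq M ∧ before i d s ≤ 1 ∧ before i d w ≤ 1) := by
    intro s hp hs' i d hid hi hd
    rcases hs'.before_cases hid (hp.count_eq d ▸ hd) hd (hp.count_eq i ▸ hi) hi with
      k | k | k | ⟨hcen, k⟩
    · exact Or.inl k
    · exact Or.inr (Or.inl k)
    · exact Or.inr (Or.inr k)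
    · exfalso
      obtain ⟨hl, e, he, hie⟩ := hs hcen i hi
      have hr : ¬ RightSq M := fun hr => hl (hr.leftSq hcen)
      have hne : i ≠ e := by rintro rfl; omega
      have hde : d ≠ e := by rintro rfl; omega
      have hd' : s.count d = 1 := hp.count_eq d ▸ hd
      have he' : s.count e = 1 := hp.count_eq e ▸ he
      have hord := hs'.before_eq hc hde he' he hd' hd
      have k' := hs'.before_cases hne he' he (hp.count_eq i ▸ hi) hi
      simp only [hl, hr, false_and, false_or] at k'
      rcases Nat.eq_zero_or_pos (before d e w) with hz | hpos
      · have k₁ := before_mono_of_eq_zero i hz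
        have k₂ := before_mono_of_eq_zero i (hord.trans hz)
        omega
      · have k₁ := before_mono_of_pos i hpos
        have k₂ := before_mono_of_pos i (hord ▸ hpos)
        omega
  induction v generalizing p u with
  | nil =>
    have := hperm.length_eq
    simp [hw] at this
    subst this
    rw [hw]
    exact fun _ => rfl
  | cons a v ih =>
    have hau : a ∈ u := by
      rw [hw, List.perm_append_left_iff] at hperm
      simp [hperm.mem_iff]
    obtain ⟨s, r, rfl, has⟩ := List.eq_append_cons_of_mem hau
    have hcond : ∀ c ∈ s, a = c ∨
        (2 ≤ (p ++ s ++ a :: r).count a ∧ 2 ≤ (p ++ s ++ a :: r).count c) ∨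
        (LeftSq M ∧ (c ∈ p ∨ a ∈ p)) ∨ (RightSq M ∧ (c ∈ r ∨ a ∈ r)) := by
      intro c hcs
      have hac : a ≠ c := fun e => has (e ▸ hcs)
      right
      have e : p ++ s ++ a :: r = p ++ (s ++ a :: r) := by simp
      rw [e, hperm.count_eq, hperm.count_eq]
      have ha0 : 0 < w.count a := by rw [hw, List.count_append, List.count_cons_self]; omega
      have hc0 : 0 < s.count c := List.count_pos_iff.2 hcs
      have hcw := hperm.count_eq c
      have haw := hperm.count_eq a
      have hc1 : 0 < w.count c := by
        rw [← hcw, List.count_append, List.count_append]; omega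
      have ha2 := h2 a
      have hc2 := h2 c
      simp only [List.count_append, List.count_cons_self, List.count_cons_of_ne hac,
        List.count_eq_zero.2 has] at hcw haw
      have mem_iff : ∀ (b : ℕ) (l : List ℕ), b ∈ l ↔ 0 < l.count b :=
        fun b l => List.count_pos_iff.symm
      rw [mem_iff c p, mem_iff c r, mem_iff a p, mem_iff a r]
      rcases Nat.lt_or_ge (w.count a) 2 with ha | ha
      · have ha1 : w.count a = 1 := by omega
        have hap : a ∉ p := by rw [← List.count_eq_zero]; omega
        have b₁ : before c a (p ++ (s ++ a :: r)) = p.count c + s.count c := by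
          rw [← List.append_assoc, before_split, List.count_append]
          simp [hap, has]
        have b₂ : before c a w = p.count c := by rw [hw, before_split _ hap]
        rcases Nat.lt_or_ge (w.count c) 2 with hc' | hc'
        · have := h.before_eq hc hac.symm (hperm.count_eq a ▸ ha1) ha1
            (hperm.count_eq c ▸ (by omega : w.count c = 1)) (by omega)
          omega
        · have k := cases _ hperm h c a hac.symm (by omega) ha1
          rw [b₁, b₂] at k
          rcases k with k | ⟨k, k₁⟩ | ⟨k, k₁⟩
          · omega
          · exact Or.inr (Or.inl ⟨k, Or.inl (by omega)⟩)
          · exact Or.inr (Or.inr ⟨k, Or.inl (by omega)⟩)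
      · rcases Nat.lt_or_ge (w.count c) 2 with hc' | hc'
        · have hc1 : w.count c = 1 := by omega
          have hcp : c ∉ p := by rw [← List.count_eq_zero]; omega
          have k := cases _ hperm h a c hac (by omega) hc1
          have b₁ : before a c (p ++ (s ++ a :: r)) = p.count a := by
            obtain ⟨s₁, s₂, rfl⟩ := List.append_of_mem hcs
            have e : p ++ (s₁ ++ c :: s₂ ++ a :: r) = (p ++ s₁) ++ c :: (s₂ ++ a :: r) := by simp
            rw [List.count_append, List.count_cons_self] at hcw
            simp only [List.mem_append, not_or] at has
            rw [e, before_split, List.count_append, List.count_eq_zero.2 has.1, add_zero]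
            rw [← List.count_eq_zero, List.count_append]
            omega
          have b₂ : p.count a + 1 ≤ before a c w := by
            have hcv : c ∈ v := by
              rw [← List.count_pos_iff]
              rw [hw, List.count_append, List.count_cons_of_ne hac] at hc1
              rw [List.count_eq_zero.2 hcp] at hc1
              omega
            obtain ⟨v₁, v₂, rfl, hv₁⟩ := List.eq_append_cons_of_mem hcv
            have e : p ++ a :: (v₁ ++ c :: v₂) = (p ++ a :: v₁) ++ c :: v₂ := by simp
            rw [hw, e, before_split]
            · rw [List.count_append, List.count_cons_self]; omega
            · simp [hcp, hv₁, hac.symm]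
          rcases k with k | ⟨k, k₁⟩ | ⟨k, k₁⟩
          · omega
          · exact Or.inr (Or.inl ⟨k, Or.inr (by omega)⟩)
          · exact Or.inr (Or.inr ⟨k, Or.inr (by omega)⟩)
        · exact Or.inl ⟨ha, hc'⟩
    have moveM : Ident M (p ++ (s ++ a :: r)) ((p ++ [a]) ++ (s ++ r)) := fun g => by
      have := hM.ev_move g a r s p hcond
      simpa using this
    have moveN : Ident N (p ++ (s ++ a :: r)) ((p ++ [a]) ++ (s ++ r)) := fun g => by
      have := hN.ev_move g a r s p fun c hcs =>
        (hcond c hcs).imp_right (Or.imp_right (Or.imp (And.imp_left T.left) (And.imp_left T.right)))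
      simpa using this
    have hperm' : ((p ++ [a]) ++ (s ++ r)).Perm w := by
      refine List.Perm.trans ?_ hperm
      rw [List.append_assoc]
      refine List.Perm.append_left p ?_
      simpa using List.perm_middle.symm
    have := ih (p ++ [a]) (s ++ r) (by simp [hw]) hperm' fun g => (moveM g).symm.trans (h g)
    exact fun g => (moveN g).trans (this g)

/-- A letter occurring at least three times in `u` and twice in `v` is gatherable in `v`. -/
lemma Transfer.gather_of_three_le (T : Transfer M N) (hM : Sat M) (hN : Sat N) {u v : List ℕ}
    (h : Ident M u v) (hM2 : ∀ a : M, a ^ 2 = a ^ 3) {i : ℕ} (hu : 3 ≤ u.count i)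
    (hv : v.count i = 2) (hlin : ∀ d, v.count d = 1 → u.count d = 1) : Gather N v i := by
  have hcen := hM.centralSq hM2
  apply hN.gather_of_count_eq_two (T.central hcen) hv
  by_contra! hcon
  obtain ⟨hl, d, hd, hb⟩ := hcon
  apply hl
  apply T.left
  intro a b
  have hid : i ≠ d := by rintro rfl; omega
  have k := h.conj hid (hlin d hd) hd a b
  have := before_le_count i d u
  rw [hM.conj_pow a b (m := before i d u) (n := u.count i - before i d u) (by omega), hv, hb,
    ← hM2 a] at k
  simpa [pow_two] using k

/-- If no linear letter of `v` separates the two occurrences of `i`, then `i` is gatherable in `u`. -/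
lemma Transfer.gather_of_gather (T : Transfer M N) (hN : Sat N) {u v : List ℕ}
    (h : Ident M u v) (hcen : CentralSq N) {i : ℕ} (hu : u.count i = 2) (hv : v.count i = 2)
    (hlin : ∀ d, u.count d = 1 → v.count d = 1)
    (hs : ∀ d, v.count d = 1 → before i d v ≠ 1) : Gather N u i := by
  apply hN.gather_of_count_eq_two hcen hu
  by_contra! hcon
  obtain ⟨hl, d, hd, hb⟩ := hcon
  have hid : i ≠ d := by rintro rfl; omega
  have hd' := hlin d hd
  have := hs d hd'
  rcases h.before_cases hid hd hd' hu hv with k | ⟨k, -⟩ | ⟨k, -⟩ | ⟨-, k⟩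
  · omega
  · exact hl (T.left k)
  · exact hl ((T.right k).leftSq hcen)
  · omega

theorem Transfer.ident (T : Transfer M N) (hM : Sat M) (hN : Sat N) (n : ℕ) (u v : List ℕ)
    (hn : u.length + v.length ≤ n) (h : Ident M u v) : Ident N u v := by
  induction n generalizing u v with
  | zero =>
    obtain rfl : u = [] := List.length_eq_zero_iff.1 (by omega)
    obtain rfl : v = [] := List.length_eq_zero_iff.1 (by omega)
    exact fun _ => rfl
  | succ n ih =>
    by_cases hg : ∃ i, (i ∈ u ∨ i ∈ v) ∧ Gather N u i ∧ Gather N v i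
    · obtain ⟨i, hi, hgu, hgv⟩ := hg
      have hlt : (u.filter (· ≠ i)).length + (v.filter (· ≠ i)).length ≤ n := by
        have k₁ := List.length_filter_le (fun j => decide (j ≠ i)) u
        have k₂ := List.length_filter_le (fun j => decide (j ≠ i)) v
        have k : ∀ w : List ℕ, i ∈ w → (w.filter (· ≠ i)).length < w.length := fun w hw =>
          List.length_filter_lt_length_iff_exists.2 ⟨i, hw, by simp⟩
        rcases hi with hi | hi
        · have := k u hi; omega
        · have := k v hi; omega
      have key := ih _ _ hlt (h.filter _)
      rw [gather_iff] at hgu hgv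
      intro g
      rw [hgu, hgv, key g, T.pow hM hN (h.pow i)]
    have hg' : ∀ i, (i ∈ u ∨ i ∈ v) → Gather N u i → ¬ Gather N v i :=
      fun i hi hu hv => hg ⟨i, hi, hu, hv⟩
    by_cases hcN : Comm N
    · rcases u with _ | ⟨i, u⟩
      · rcases v with _ | ⟨i, v⟩
        · exact fun _ => rfl
        · exact (hg' i (by simp) (hcN.gather _ _) (hcN.gather _ _)).elim
      · exact (hg' i (by simp) (hcN.gather _ _) (hcN.gather _ _)).elim
    have hcM : ¬ Comm M := fun hc => hcN (T.comm hc)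
    have hmem : ∀ {i}, 2 ≤ u.count i → i ∈ u := fun hi => List.count_pos_iff.1 (by omega)
    have cnt : ∀ {u v : List ℕ}, Ident M u v → ∀ i, u.count i < v.count i →
        2 ≤ u.count i ∧ (u.count i = 2 → ∀ a : M, a ^ 2 = a ^ 3) :=
      fun h i hlt => hM.pow_cases hcM hlt (h.pow i)
    have h' : Ident M v u := fun g => (h g).symm
    have hlin : ∀ d, u.count d = 1 ↔ v.count d = 1 := fun d => by
      have k₁ := cnt h d
      have k₂ := cnt h' d
      omega
    have hcount : ∀ i, u.count i = v.count i := by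
      intro i
      rcases lt_trichotomy (u.count i) (v.count i) with hlt | heq | hlt
      · obtain ⟨k, k'⟩ := cnt h i hlt
        rcases Nat.lt_or_ge 2 (u.count i) with hu | hu
        · exact (hg' i (Or.inl (hmem k)) (hN.gather_of_three_le hu)
            (hN.gather_of_three_le (by omega))).elim
        · exact (hg' i (Or.inl (hmem k)) (T.gather_of_three_le hM hN h' (k' (by omega)) (by omega)
            (by omega) fun d hd => (hlin d).1 hd) (hN.gather_of_three_le (by omega))).elim
      · exact heq
      · obtain ⟨k, k'⟩ := cnt h' i hlt
        rcases Nat.lt_or_ge 2 (v.count i) with hv | hv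
        · exact (hg' i (Or.inl (hmem (by omega))) (hN.gather_of_three_le (by omega))
            (hN.gather_of_three_le hv)).elim
        · exact (hg' i (Or.inl (hmem (by omega))) (hN.gather_of_three_le (by omega))
            (T.gather_of_three_le hM hN h (k' (by omega)) (by omega)
            (by omega) fun d hd => (hlin d).2 hd)).elim
    refine T.ident_of_perm hM hN hcM (w := v) ?_ ?_ v [] u rfl ?_ h
    · intro i
      by_contra hi
      have := hcount i
      exact hg' i (Or.inl (hmem (by omega))) (hN.gather_of_three_le (by omega))
        (hN.gather_of_three_le (by omega))
    · intro hcen i hv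
      have hcen := T.central hcen
      have hu : u.count i = 2 := by rw [hcount, hv]
      have hi : i ∈ u ∨ i ∈ v := Or.inl (hmem hu.ge)
      constructor
      · intro hl
        have hl := T.left hl
        exact hg' i hi (hN.gather_of_count_eq_two hcen hu (Or.inl hl))
          (hN.gather_of_count_eq_two hcen hv (Or.inl hl))
      · by_contra! hs
        exact hg' i hi (T.gather_of_gather hN h hcen hu hv (fun d => (hlin d).1) hs)
          (hN.gather_of_count_eq_two hcen hv (Or.inr hs))
    · exact List.perm_iff_count.2 hcount

/-- Seven identities that separate the congruences above `sigmaRR`. -/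
def testPair : Fin 7 → List ℕ × List ℕ :=
  ![([], [0]), ([0], [0, 0]), ([0, 0], [0, 0, 0]), ([0, 1], [1, 0]), ([0, 0, 1], [0, 1, 0]),
    ([0, 1, 0], [1, 0, 0]), ([0, 0, 1], [1, 0, 0])]

/-- The monoid `M` satisfies the `i`-th test identity. -/
def Test (M : Type*) [Monoid M] (i : Fin 7) : Prop := Ident M (testPair i).1 (testPair i).2

lemma forall_assign {α : Type*} {P : α → α → Prop} : (∀ g : ℕ → α, P (g 0) (g 1)) ↔ ∀ a b, P a b :=
  ⟨fun h a b => by simpa using h (fun n => if n = 0 then a else b), fun h _ => h _ _⟩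

lemma forall_assign_one {α : Type*} {P : α → Prop} : (∀ g : ℕ → α, P (g 0)) ↔ ∀ a, P a :=
  ⟨fun h a => h fun _ => a, fun h _ => h _⟩

lemma test_zero : Test M 0 ↔ ∀ a : M, 1 = a := by
  rw [← forall_assign_one]; simp [Test, testPair, Ident]

lemma test_one : Test M 1 ↔ ∀ a : M, a = a * a := by
  rw [← forall_assign_one]; simp [Test, testPair, Ident]

lemma test_two : Test M 2 ↔ ∀ a : M, a * a = a * a * a := by
  rw [← forall_assign_one]; simp [Test, testPair, Ident, mul_assoc]

lemma test_three : Test M 3 ↔ Comm M := by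
  rw [Comm, ← forall_assign]; simp [Test, testPair, Ident]

lemma test_four : Test M 4 ↔ LeftSq M := by
  rw [LeftSq, ← forall_assign]; simp [Test, testPair, Ident, mul_assoc]

lemma test_five : Test M 5 ↔ RightSq M := by
  rw [RightSq, ← forall_assign]; simp [Test, testPair, Ident, mul_assoc]

lemma test_six : Test M 6 ↔ CentralSq M := by
  rw [CentralSq, ← forall_assign]; simp [Test, testPair, Ident, mul_assoc]

lemma Transfer.of_test (h : ∀ i, Test M i → Test N i) : Transfer M N where
  one := by simpa only [test_zero] using h 0
  sq := by simpa only [test_one] using h 1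
  cube := by simpa only [test_two] using h 2
  comm := by simpa only [test_three] using h 3
  left := by simpa only [test_four] using h 4
  right := by simpa only [test_five] using h 5
  central := by simpa only [test_six] using h 6

/-- The monoid `M` lies in the variety defined by `sigmaRR` and satisfies exactly those test
identities that `b` marks. -/
structure HasProfile (M : Type*) [Monoid M] (b : Fin 7 → Bool) : Prop where
  sat : Sat M
  test : ∀ i, Test M i ↔ b i = true

lemma ident_prod {u v : List ℕ} : Ident (M × N) u v ↔ Ident M u v ∧ Ident N u v := by
  have e : ∀ (g : ℕ → M × N) (w : List ℕ),
      ev g w = (ev (fun i => (g i).1) w, ev (fun i => (g i).2) w) := fun g w => by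
    induction w with
    | nil => rfl
    | cons c w ih => simp only [ev_cons, ih]; rfl
  constructor
  · intro h
    constructor
    · intro g
      have := h fun i => (g i, 1)
      rw [e, e] at this
      exact congrArg Prod.fst this
    · intro g
      have := h fun i => (1, g i)
      rw [e, e] at this
      exact congrArg Prod.snd this
  · rintro ⟨h, h'⟩ g
    rw [e, e, h, h']

lemma Sat.prod (h : Sat M) (h' : Sat N) : Sat (M × N) where
  pow_four _ := Prod.ext (h.pow_four _) (h'.pow_four _)
  cube _ _ _ _ := Prod.ext (h.cube ..) (h'.cube ..)
  first_first _ _ _ _ := Prod.ext (h.first_first ..) (h'.first_first ..)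
  second_first _ _ _ _ := Prod.ext (h.second_first ..) (h'.second_first ..)
  second_second _ _ _ _ := Prod.ext (h.second_second ..) (h'.second_second ..)

lemma HasProfile.prod {b c : Fin 7 → Bool} (h : HasProfile M b) (h' : HasProfile N c) :
    HasProfile (M × N) (fun i => b i && c i) where
  sat := h.sat.prod h'.sat
  test i := by
    rw [Test, ident_prod, ← Test, ← Test, h.test, h'.test, Bool.and_eq_true]

section Table

variable {n : ℕ}

/-- The table `T` is the multiplication table of a monoid with unit `0`. -/
structure IsMonoidTable (T : Fin (n + 1) → Fin (n + 1) → Fin (n + 1)) : Prop where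
  assoc : ∀ a b c, T (T a b) c = T a (T b c)
  zero_left : ∀ a, T 0 a = a
  zero_right : ∀ a, T a 0 = a

/-- The monoid with multiplication table `T`. -/
def TableMonoid {T : Fin (n + 1) → Fin (n + 1) → Fin (n + 1)} (_ : IsMonoidTable T) : Type :=
  Fin (n + 1)

instance {T : Fin (n + 1) → Fin (n + 1) → Fin (n + 1)} (h : IsMonoidTable T) :
    Monoid (TableMonoid h) where
  mul := T
  one := (0 : Fin (n + 1))
  mul_assoc := h.assoc
  one_mul := h.zero_left
  mul_one := h.zero_right

lemma hasProfile_tableMonoid {T : Fin (n + 1) → Fin (n + 1) → Fin (n + 1)}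
    (h : IsMonoidTable T) (b : Fin 7 → Bool)
    (h₁ : ∀ a, T (T (T a a) a) a = T (T a a) a)
    (h₂ : ∀ a b c d, T (T (T (T (T a a) a) b) c) d = T (T (T (T (T b a) c) a) d) a)
    (h₃ : ∀ a b c d, T (T (T (T (T a b) c) a) d) b = T (T (T (T (T b a) c) a) d) b)
    (h₄ : ∀ a b c d, T (T (T (T (T a c) a) b) d) b = T (T (T (T (T a c) b) a) d) b)
    (h₅ : ∀ a b c d, T (T (T (T (T a d) b) c) a) b = T (T (T (T (T a d) b) c) b) a)
    (k₀ : (∀ a : Fin (n + 1), 0 = a) ↔ b 0 = true)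
    (k₁ : (∀ a, a = T a a) ↔ b 1 = true)
    (k₂ : (∀ a, T a a = T (T a a) a) ↔ b 2 = true)
    (k₃ : (∀ a c, T a c = T c a) ↔ b 3 = true)
    (k₄ : (∀ a c, T (T a a) c = T (T a c) a) ↔ b 4 = true)
    (k₅ : (∀ a c, T (T a c) a = T (T c a) a) ↔ b 5 = true)
    (k₆ : (∀ a c, T (T a a) c = T (T c a) a) ↔ b 6 = true) :
    HasProfile (TableMonoid h) b where
  sat :=
    { pow_four := fun a => by
        simp only [pow_succ, pow_zero, one_mul]
        exact h₁ a
      cube := fun a b c d => by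
        simp only [pow_succ, pow_zero, one_mul]
        exact h₂ a b c d
      first_first := h₃
      second_first := h₄
      second_second := h₅ }
  test := by
    rw [Fin.forall_fin_succ, Fin.forall_fin_succ, Fin.forall_fin_succ, Fin.forall_fin_succ,
      Fin.forall_fin_succ, Fin.forall_fin_succ, Fin.forall_fin_one]
    exact ⟨test_zero.trans k₀, test_one.trans k₁, test_two.trans k₂, test_three.trans k₃,
      test_four.trans k₄, test_five.trans k₅, test_six.trans k₆⟩

end Table

/-- The table of addition on `{0, …, n}` truncated at `n`. -/
def capTable (n : ℕ) (a b : Fin (n + 1)) : Fin (n + 1) :=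
  ⟨min (a + b) n, Nat.lt_succ_of_le (min_le_right _ _)⟩

lemma isMonoidTable_cap (n : ℕ) : IsMonoidTable (capTable n) where
  assoc a b c := by simp only [capTable, Fin.mk.injEq]; omega
  zero_left a := by ext; simp [capTable]; omega
  zero_right a := by ext; simp [capTable]; omega

/-- The table of `{1, x, y, xy, 0}`, the Rees quotient given by the factors of `xy`. -/
def factorTableXY : Fin 5 → Fin 5 → Fin 5 :=
  ![![0, 1, 2, 3, 4],
    ![1, 4, 3, 4, 4],
    ![2, 4, 4, 4, 4],
    ![3, 4, 4, 4, 4],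
    ![4, 4, 4, 4, 4]]

/-- The table of `{1, x, t, xt, tx, xtx, 0}`, the Rees quotient given by the factors of `xtx`. -/
def factorTableXTX : Fin 7 → Fin 7 → Fin 7 :=
  ![![0, 1, 2, 3, 4, 5, 6],
    ![1, 6, 3, 6, 5, 6, 6],
    ![2, 4, 6, 6, 6, 6, 6],
    ![3, 5, 6, 6, 6, 6, 6],
    ![4, 6, 6, 6, 6, 6, 6],
    ![5, 6, 6, 6, 6, 6, 6],
    ![6, 6, 6, 6, 6, 6, 6]]

/-- The table of `{1, x, t, x², tx, tx², 0}`, the Rees quotient given by the factors of `tx²`. -/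
def factorTableTXX : Fin 7 → Fin 7 → Fin 7 :=
  ![![0, 1, 2, 3, 4, 5, 6],
    ![1, 3, 6, 6, 6, 6, 6],
    ![2, 4, 6, 5, 6, 6, 6],
    ![3, 6, 6, 6, 6, 6, 6],
    ![4, 5, 6, 6, 6, 6, 6],
    ![5, 6, 6, 6, 6, 6, 6],
    ![6, 6, 6, 6, 6, 6, 6]]

lemma isMonoidTable_xy : IsMonoidTable factorTableXY := by
  constructor <;> decide +kernel

lemma isMonoidTable_xtx : IsMonoidTable factorTableXTX := by
  constructor <;> decide +kernel

lemma isMonoidTable_txx : IsMonoidTable factorTableTXX := by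
  constructor <;> decide +kernel

lemma isMonoidTable_xxt : IsMonoidTable (fun a b => factorTableTXX b a) := by
  constructor <;> decide +kernel

abbrev Cap (n : ℕ) : Type := TableMonoid (isMonoidTable_cap n)
abbrev FactorXY : Type := TableMonoid isMonoidTable_xy
abbrev FactorXTX : Type := TableMonoid isMonoidTable_xtx
abbrev FactorTXX : Type := TableMonoid isMonoidTable_txx
abbrev FactorXXT : Type := TableMonoid isMonoidTable_xxt

lemma hasProfile_cap_zero :
    HasProfile (Cap 0) ![true, true, true, true, true, true, true] := by
  apply hasProfile_tableMonoid <;> decide +kernel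

lemma hasProfile_cap_one :
    HasProfile (Cap 1) ![false, true, true, true, true, true, true] := by
  apply hasProfile_tableMonoid <;> decide +kernel

lemma hasProfile_cap_two :
    HasProfile (Cap 2) ![false, false, true, true, true, true, true] := by
  apply hasProfile_tableMonoid <;> decide +kernel

lemma hasProfile_cap_three :
    HasProfile (Cap 3) ![false, false, false, true, true, true, true] := by
  apply hasProfile_tableMonoid <;> decide +kernel

lemma hasProfile_xy :
    HasProfile FactorXY ![false, false, true, false, true, true, true] := by
  apply hasProfile_tableMonoid <;> decide +kernel

lemma hasProfile_xtx :
    HasProfile FactorXTX ![false, false, true, false, false, false, true] := by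
  apply hasProfile_tableMonoid <;> decide +kernel

lemma hasProfile_txx :
    HasProfile FactorTXX ![false, false, false, false, true, false, false] := by
  apply hasProfile_tableMonoid <;> decide +kernel

lemma hasProfile_xxt :
    HasProfile FactorXXT ![false, false, false, false, false, true, false] := by
  apply hasProfile_tableMonoid <;> decide +kernel

/-- The congruence of all identities of `M`. -/
def idn (M : Type*) [Monoid M] : FICon :=
  ⟨{ r := fun u v => ∀ g : ℕ → M, FreeMonoid.lift g u = FreeMonoid.lift g v
     iseqv := ⟨fun _ _ => rfl, fun h g => (h g).symm, fun h h' g => (h g).trans (h' g)⟩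
     mul' := fun h h' g => by rw [map_mul, map_mul, h, h'] },
   fun ξ u v h g => by
    have e : ∀ w, FreeMonoid.lift g (ξ w) = FreeMonoid.lift (fun i => FreeMonoid.lift g (ξ (.of i))) w :=
      fun w => by
        have : (FreeMonoid.lift g).comp ξ =
            FreeMonoid.lift (fun i => FreeMonoid.lift g (ξ (.of i))) :=
          FreeMonoid.hom_eq fun i => by simp
        exact DFunLike.congr_fun this w
    exact (e u).trans ((h _).trans (e v).symm)⟩

lemma lift_ofList (g : ℕ → M) (w : List ℕ) : FreeMonoid.lift g (FreeMonoid.ofList w) = ev g w := by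
  rw [FreeMonoid.lift_apply]; rfl

lemma idn_ofList {u v : List ℕ} :
    (idn M).1 (FreeMonoid.ofList u) (FreeMonoid.ofList v) ↔ Ident M u v :=
  forall_congr' fun g => by rw [lift_ofList, lift_ofList]

/-- A fully invariant congruence consists of the identities of the quotient by it. -/
lemma rel_iff (ρ : FICon) (u v : F) :
    ρ.1 u v ↔ ∀ g : ℕ → ρ.1.Quotient, FreeMonoid.lift g u = FreeMonoid.lift g v := by
  have e : ∀ (ξ : F →* F) (w : F), (ξ w : ρ.1.Quotient) =
      FreeMonoid.lift (fun i => (ξ (.of i) : ρ.1.Quotient)) w := fun ξ w => by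
    have : ρ.1.mk'.comp ξ = FreeMonoid.lift (fun i => (ξ (.of i) : ρ.1.Quotient)) :=
      FreeMonoid.hom_eq fun i => by simp
    exact DFunLike.congr_fun this w
  constructor
  · intro h g
    obtain ⟨f, hf⟩ : ∃ f : ℕ → F, ∀ i, (f i : ρ.1.Quotient) = g i :=
      ⟨fun i => (g i).out, fun i => Quotient.out_eq _⟩
    have k := ρ.1.eq.2 (ρ.2 (FreeMonoid.lift f) u v h)
    rw [e, e] at k
    simpa [hf] using k
  · intro h
    have k := h fun i => (FreeMonoid.of i : F)
    have e := e (MonoidHom.id F)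
    simp only [MonoidHom.id_apply] at e
    rw [← e, ← e] at k
    exact ρ.1.eq.1 k

lemma ident_quotient (ρ : FICon) {u v : List ℕ} :
    Ident ρ.1.Quotient u v ↔ ρ.1 (FreeMonoid.ofList u) (FreeMonoid.ofList v) := by
  rw [rel_iff]
  exact forall_congr' fun g => by rw [lift_ofList, lift_ofList]

lemma test_idn (i : Fin 7) : Test (idn M).1.Quotient i ↔ Test M i :=
  (ident_quotient _).trans idn_ofList

lemma fic_le_iff {S : Set (F × F)} {ρ : FICon} : fic S ≤ ρ ↔ ∀ p ∈ S, ρ.1 p.1 p.2 := by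
  constructor
  · intro h p hp
    apply h
    rintro c ⟨d, hd, rfl⟩
    exact hd p hp
  · intro h
    exact sInf_le h

/-- Specialising the four letters used in `sigmaRR`. -/
lemma forall_letters {α : Type*} {P : α → α → α → α → Prop} :
    (∀ g : ℕ → α, P (g 0) (g 1) (g 2) (g 3)) ↔ ∀ a b c d, P a b c d :=
  ⟨fun h a b c d => by
    simpa using h (fun n => if n = 0 then a else if n = 1 then b else if n = 2 then c else d),
    fun h _ => h _ _ _ _⟩

lemma sigmaRR_le_iff (ρ : FICon) : sigmaRR ≤ ρ ↔ Sat ρ.1.Quotient := by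
  rw [sigmaRR, fic_le_iff]
  simp only [Set.mem_insert_iff, Set.mem_singleton_iff, forall_eq_or_imp, forall_eq, rel_iff,
    map_mul, map_pow, x, y, z, t, FreeMonoid.lift_eval_of]
  constructor
  · rintro ⟨h₁, h₂, h₃, h₄, h₅⟩
    exact ⟨forall_assign_one.1 h₁, forall_letters.1 h₂, forall_letters.1 h₃, forall_letters.1 h₄,
      forall_letters.1 h₅⟩
  · intro h
    exact ⟨fun g => h.pow_four _, fun g => h.cube .., fun g => h.first_first ..,
      fun g => h.second_first .., fun g => h.second_second ..⟩

lemma Sat.idn (h : Sat M) : Sat (idn M).1.Quotient := by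
  rw [← sigmaRR_le_iff, sigmaRR, fic_le_iff]
  simp only [Set.mem_insert_iff, Set.mem_singleton_iff, forall_eq_or_imp, forall_eq]
  refine ⟨fun g => ?_, fun g => ?_, fun g => ?_, fun g => ?_, fun g => ?_⟩ <;>
    simp only [map_mul, map_pow]
  exacts [h.pow_four _, h.cube .., h.first_first .., h.second_first .., h.second_second ..]

lemma le_of_test {ρ ρ' : FICon} (h : sigmaRR ≤ ρ) (h' : sigmaRR ≤ ρ')
    (ht : ∀ i, Test ρ.1.Quotient i → Test ρ'.1.Quotient i) : ρ ≤ ρ' := by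
  intro u v huv
  have := (Transfer.of_test ht).ident ((sigmaRR_le_iff ρ).1 h) ((sigmaRR_le_iff ρ').1 h') _
    u.toList v.toList le_rfl ((ident_quotient ρ).2 (by simpa using huv))
  simpa using (ident_quotient ρ').1 this

/-- Representatives of the congruences above `sigmaRR`. -/
def representative : Fin 11 → FICon :=
  ![idn (Cap 0), idn (Cap 1), idn (Cap 2), idn (Cap 3), idn FactorXY, idn (Cap 3 × FactorXY),
    idn FactorXTX, idn (Cap 3 × FactorXTX), idn FactorTXX, idn FactorXXT,
    idn (FactorTXX × FactorXXT)]

/-- The test identities in the representatives. -/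
def profile : Fin 11 → Fin 7 → Bool :=
  ![![true, true, true, true, true, true, true],
    ![false, true, true, true, true, true, true],
    ![false, false, true, true, true, true, true],
    ![false, false, false, true, true, true, true],
    ![false, false, true, false, true, true, true],
    ![false, false, false, false, true, true, true],
    ![false, false, true, false, false, false, true],
    ![false, false, false, false, false, false, true],
    ![false, false, false, false, true, false, false],
    ![false, false, false, false, false, true, false],
    ![false, false, false, false, false, false, false]]

lemma HasProfile.idn {b c : Fin 7 → Bool} (h : HasProfile M b) (hbc : ∀ i, b i = c i) :
    HasProfile (idn M).1.Quotient c :=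
  ⟨h.sat.idn, fun i => by rw [test_idn, h.test, hbc]⟩

lemma hasProfile_representative (k : Fin 11) :
    HasProfile (representative k).1.Quotient (profile k) := by
  fin_cases k
  · exact hasProfile_cap_zero.idn (by decide)
  · exact hasProfile_cap_one.idn (by decide)
  · exact hasProfile_cap_two.idn (by decide)
  · exact hasProfile_cap_three.idn (by decide)
  · exact hasProfile_xy.idn (by decide)
  · exact (hasProfile_cap_three.prod hasProfile_xy).idn (by decide)
  · exact hasProfile_xtx.idn (by decide)
  · exact (hasProfile_cap_three.prod hasProfile_xtx).idn (by decide)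
  · exact hasProfile_txx.idn (by decide)
  · exact hasProfile_xxt.idn (by decide)
  · exact (hasProfile_txx.prod hasProfile_xxt).idn (by decide)

lemma exists_profile_eq (b : Fin 7 → Bool) (h : (b 0 → b 1) ∧ (b 1 → b 2 ∧ b 3) ∧
    (b 2 → b 6) ∧ (b 3 → b 4 ∧ b 5) ∧ (b 4 → b 5 → b 6) ∧ (b 4 → b 6 → b 5) ∧
    (b 5 → b 6 → b 4)) : ∃ k, ∀ i, profile k i = b i := by
  revert b
  decide +kernel

lemma Sat.exists_profile (h : Sat M) : ∃ k, ∀ i, Test M i ↔ profile k i = true := by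
  classical
  suffices hs : (Test M 0 → Test M 1) ∧ (Test M 1 → Test M 2 ∧ Test M 3) ∧
      (Test M 2 → Test M 6) ∧ (Test M 3 → Test M 4 ∧ Test M 5) ∧
      (Test M 4 → Test M 5 → Test M 6) ∧ (Test M 4 → Test M 6 → Test M 5) ∧
      (Test M 5 → Test M 6 → Test M 4) by
    obtain ⟨k, hk⟩ := exists_profile_eq (fun i => decide (Test M i))
      (by simpa only [decide_eq_true_eq] using hs)
    exact ⟨k, fun i => by simp [hk]⟩
  simp only [test_zero, test_one, test_two, test_three, test_four, test_five, test_six]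
  refine ⟨?_, ?_, ?_, ?_, LeftSq.centralSq, LeftSq.rightSq, RightSq.leftSq⟩
  · exact fun h' a => (h' a).symm.trans (h' _)
  · intro h'
    refine ⟨fun a => by rw [← h' a]; exact h' a, h.comm (m := 1) le_rfl fun a => ?_⟩
    simpa [pow_two] using h' a
  · exact fun h' => h.centralSq fun a => by simpa [pow_succ] using h' a
  · exact fun h' => ⟨leftSq_of_comm h',
      (leftSq_of_comm h').rightSq fun a b => by rw [h' (a * a), mul_assoc]⟩

end WordIdentity

open WordIdentity

/-- The interval `[σ_RRδ, ⊤]` of the lattice of fully invariant congruences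
on `F` contains exactly 11 elements; equivalently, the monoid variety
`R ∨ R^δ` has exactly 11 subvarieties. -/
theorem interval_card_eleven : Nat.card (Set.Icc sigmaRR (⊤ : FICon)) = 11 := by
  have hle (k : Fin 11) : sigmaRR ≤ representative k :=
    (sigmaRR_le_iff _).2 (hasProfile_representative k).sat
  have hbij : Function.Bijective
      (fun k : Fin 11 => (⟨representative k, hle k, le_top⟩ : Set.Icc sigmaRR (⊤ : FICon))) := by
    constructor
    · intro k l hkl
      have hkl : representative k = representative l := congrArg Subtype.val hkl
      have hinj : Function.Injective profile := by decide +kernel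
      apply hinj
      funext i
      rw [Bool.eq_iff_iff, ← (hasProfile_representative k).test,
        ← (hasProfile_representative l).test, hkl]
    · rintro ⟨ρ, hρ, -⟩
      obtain ⟨k, hk⟩ := ((sigmaRR_le_iff ρ).1 hρ).exists_profile
      refine ⟨k, Subtype.ext (le_antisymm ?_ ?_)⟩
      · exact le_of_test (hle k) hρ fun i => by
          rw [hk, (hasProfile_representative k).test]; exact id
      · exact le_of_test hρ (hle k) fun i => by
          rw [hk, (hasProfile_representative k).test]; exact id
  rw [← Nat.card_congr (Equiv.ofBijective _ hbij), Nat.card_fin]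
end
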